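/- arXiv:math/0305410 — 2 statements merged into one kernel-verified Lean document; each statement's English description precedes it below -/
import Mathlib

section
/- Let f : ℝ₊ → ℝ₊ be a strictly increasing continuous function, let K be a convex body in ℝⁿ, and let N ≥ n + 1. Then E f(U_{K,N}) ≥ E f(U_{B₂ⁿ,N}), where B₂ⁿ is the Euclidean unit ball in ℝⁿ. That is, among all convex bodies, every strictly increasing continuous moment functional of the normalized volume of a random polytope on N independent uniform points is minimized by the Euclidean ball. -/
open MeasureTheory

/-- The uniform probability measure on a set `K` in `ℝⁿ`. -/
noncomputable def unifMeasure (n : ℕ) (K : Set (EuclideanSpace ℝ (Fin n))) :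
    Measure (EuclideanSpace ℝ (Fin n)) :=
  (volume K)⁻¹ • volume.restrict K

/-- The joint distribution of `N` independent uniform random points in `K`. -/
noncomputable def jointUnif (n N : ℕ) (K : Set (EuclideanSpace ℝ (Fin n))) :
    Measure (Fin N → EuclideanSpace ℝ (Fin n)) :=
  Measure.pi fun _ => unifMeasure n K

/-- `U_{K,N}`: the volume of the convex hull of the points `x 0, …, x (N-1)`,
normalized by the volume of `K`. -/
noncomputable def randPolyVol (n N : ℕ) (K : Set (EuclideanSpace ℝ (Fin n)))
    (x : Fin N → EuclideanSpace ℝ (Fin n)) : ℝ :=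
  (volume (convexHull ℝ (Set.range x))).toReal / (volume K).toReal


open Set Metric
open scoped ENNReal

/-! ### The Brunn-Minkowski and Prékopa-Leindler inequalities -/

/-- The one-dimensional Brunn-Minkowski inequality for compact sets. -/
theorem IsCompact.volume_add_volume_le {A B C : Set ℝ} (hA : IsCompact A) (hB : IsCompact B)
    (hA' : A.Nonempty) (hB' : B.Nonempty) (h : ∀ a ∈ A, ∀ b ∈ B, a + b ∈ C) :
    volume A + volume B ≤ volume C := by
  obtain ⟨a, ha, hamax⟩ := hA.exists_isGreatest hA'
  obtain ⟨b, hb, hbmin⟩ := hB.exists_isLeast hB'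
  have hdisj : AEDisjoint volume ((fun x => x + -b) ⁻¹' A) ((fun x => x + -a) ⁻¹' B) := by
    refine measure_mono_null (t := {a + b}) ?_ (by simp)
    rintro x ⟨hxA, hxB⟩
    have h1 := hamax hxA
    have h2 := hbmin hxB
    simp only [mem_singleton_iff]
    linarith
  have hmeas : NullMeasurableSet ((fun x => x + -a) ⁻¹' B) volume :=
    (hB.measurableSet.preimage (measurable_add_const _)).nullMeasurableSet
  rw [← measure_preimage_add_right volume (-b) A, ← measure_preimage_add_right volume (-a) B,
    ← measure_union₀ hmeas hdisj]
  refine measure_mono ?_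
  rintro x (hx | hx)
  · simpa using h _ hx _ hb
  · simpa using h _ ha _ hx

/-- The one-dimensional Brunn-Minkowski inequality. -/
theorem volume_add_volume_le_of_add_mem {A B C : Set ℝ} (hA : MeasurableSet A)
    (hB : MeasurableSet B) (hA' : A.Nonempty) (hB' : B.Nonempty)
    (h : ∀ a ∈ A, ∀ b ∈ B, a + b ∈ C) :
    volume A + volume B ≤ volume C := by
  obtain ⟨a₀, ha₀⟩ := hA'
  obtain ⟨b₀, hb₀⟩ := hB'
  have key : ∀ A' ⊆ A, IsCompact A' → ∀ B' ⊆ B, IsCompact B' →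
      volume A' + volume B' ≤ volume C := by
    intro A' hAA hAc B' hBB hBc
    refine le_trans (add_le_add (measure_mono (subset_insert a₀ A'))
      (measure_mono (subset_insert b₀ B'))) ?_
    refine (hAc.insert a₀).volume_add_volume_le (hBc.insert b₀) ⟨a₀, by simp⟩ ⟨b₀, by simp⟩ ?_
    intro a ha b hb
    exact h a (insert_subset ha₀ hAA ha) b (insert_subset hb₀ hBB hb)
  have key2 : ∀ B' ⊆ B, IsCompact B' → volume A + volume B' ≤ volume C := by
    intro B' hBB hBc
    have hfin : volume B' ≠ ∞ := hBc.measure_lt_top.ne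
    rcases le_total (volume B') (volume C) with hle | hle
    · have : volume A ≤ volume C - volume B' := by
        rw [hA.measure_eq_iSup_isCompact]
        exact iSup₂_le fun A' hAA => iSup_le fun hAc =>
          ENNReal.le_sub_of_add_le_right hfin (key A' hAA hAc B' hBB hBc)
      calc volume A + volume B' ≤ volume C - volume B' + volume B' := by gcongr
        _ = volume C := tsub_add_cancel_of_le hle
    · have : volume A ≤ volume C - volume B' := by
        rw [hA.measure_eq_iSup_isCompact]
        exact iSup₂_le fun A' hAA => iSup_le fun hAc =>
          ENNReal.le_sub_of_add_le_right hfin (key A' hAA hAc B' hBB hBc)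
      have h0 : volume A = 0 := by
        rw [tsub_eq_zero_of_le hle] at this
        exact le_antisymm this zero_le
      rw [h0]
      simpa using key ∅ (empty_subset _) isCompact_empty B' hBB hBc
  rcases eq_or_ne (volume A) ∞ with hAt | hAt
  · have := key2 ∅ (empty_subset _) isCompact_empty
    rw [hAt] at this ⊢
    simpa using this
  rw [hB.measure_eq_iSup_isCompact, ENNReal.add_iSup]
  refine iSup_le fun B' => ?_
  by_cases hBB : B' ⊆ B
  · by_cases hBc : IsCompact B'
    · simpa [hBB, hBc] using key2 B' hBB hBc
    · simpa [hBB, hBc] using (le_self_add).trans (key2 ∅ (empty_subset _) isCompact_empty)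
  · simpa [hBB] using (le_self_add).trans (key2 ∅ (empty_subset _) isCompact_empty)

/-- The layer cake formula for a function with values in `[0, ∞)`. -/
theorem lintegral_eq_lintegral_measure_ofReal_lt {α : Type*} [MeasurableSpace α] (μ : Measure α)
    {f : α → ℝ≥0∞} (hf : Measurable f) (hfin : ∀ x, f x ≠ ∞) :
    ∫⁻ x, f x ∂μ = ∫⁻ t in Ioi (0 : ℝ), μ {x | ENNReal.ofReal t < f x} := by
  have h1 : ∫⁻ x, f x ∂μ = ∫⁻ x, ENNReal.ofReal (f x).toReal ∂μ :=
    lintegral_congr fun x => (ENNReal.ofReal_toReal (hfin x)).symm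
  rw [h1, lintegral_eq_lintegral_meas_lt μ (Filter.Eventually.of_forall fun x =>
    ENNReal.toReal_nonneg) hf.ennreal_toReal.aemeasurable]
  refine setLIntegral_congr_fun measurableSet_Ioi fun t ht => ?_
  have ht' : (0 : ℝ) ≤ t := le_of_lt ht
  simp only [ENNReal.ofReal_lt_iff_lt_toReal ht' (hfin _)]

/-- The additive form of the Prékopa-Leindler inequality on the line, for functions
with supremum one. -/
theorem lintegral_add_lintegral_le_two_mul {f g h : ℝ → ℝ≥0∞} (hf : Measurable f)
    (hg : Measurable g) (hh : Measurable h) (hf1 : ⨆ x, f x = 1) (hg1 : ⨆ x, g x = 1)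
    (H : ∀ x y, f x * g y ≤ h ((x + y) / 2) ^ 2) :
    (∫⁻ x, f x) + ∫⁻ x, g x ≤ 2 * ∫⁻ x, h x := by
  have hf_le : ∀ x, f x ≤ 1 := fun x => hf1 ▸ le_iSup f x
  have hg_le : ∀ x, g x ≤ 1 := fun x => hg1 ▸ le_iSup g x
  have hk : Measurable fun x => min (h x) 1 := hh.min measurable_const
  refine le_trans ?_ (mul_le_mul_right (lintegral_mono fun x => min_le_left (h x) 1) 2)
  rw [lintegral_eq_lintegral_measure_ofReal_lt _ hf fun x => ((hf_le x).trans_lt (by simp)).ne,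
    lintegral_eq_lintegral_measure_ofReal_lt _ hg fun x => ((hg_le x).trans_lt (by simp)).ne,
    lintegral_eq_lintegral_measure_ofReal_lt _ hk fun x =>
      ((min_le_right (h x) 1).trans_lt (by simp)).ne]
  have hanti : Measurable fun t : ℝ => volume {x | ENNReal.ofReal t < f x} := by
    refine Antitone.measurable fun s t hst => measure_mono fun x hx => ?_
    exact lt_of_le_of_lt (ENNReal.ofReal_le_ofReal hst) hx
  rw [← lintegral_add_left hanti, ← lintegral_const_mul' _ _ (by simp)]
  refine setLIntegral_mono_ae' measurableSet_Ioi (Filter.Eventually.of_forall fun t ht => ?_)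
  rcases lt_or_ge t 1 with ht1 | ht1
  · have ht1' : ENNReal.ofReal t < 1 := by simpa using ht1
    have hfne : {x | ENNReal.ofReal t < f x}.Nonempty := by
      have := lt_iSup_iff.1 (hf1.symm ▸ ht1'); exact this
    have hgne : {x | ENNReal.ofReal t < g x}.Nonempty := by
      have := lt_iSup_iff.1 (hg1.symm ▸ ht1'); exact this
    have hscale : volume ((fun x : ℝ => (2⁻¹ : ℝ) • x) ⁻¹' {x | ENNReal.ofReal t < min (h x) 1}) =
        2 * volume {x | ENNReal.ofReal t < min (h x) 1} := by
      rw [Measure.addHaar_preimage_smul _ (by norm_num)]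
      norm_num
    rw [← hscale]
    refine volume_add_volume_le_of_add_mem (measurableSet_lt measurable_const hf)
      (measurableSet_lt measurable_const hg) hfne hgne fun x hx y hy => ?_
    simp only [mem_preimage, mem_ofPred_eq, lt_min_iff]
    refine ⟨?_, ht1'⟩
    have h2 := (ENNReal.mul_lt_mul hx hy).trans_le (H x y)
    rw [← sq] at h2
    have h3 := lt_of_pow_lt_pow_left' 2 h2
    convert h3 using 2
    simp only [smul_eq_mul]; ring
  · have ht1' : 1 ≤ ENNReal.ofReal t := by simpa using ht1
    have e1 : {x | ENNReal.ofReal t < f x} = ∅ :=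
      eq_empty_of_forall_notMem fun x hx => absurd hx (not_lt.2 ((hf_le x).trans ht1'))
    have e2 : {x | ENNReal.ofReal t < g x} = ∅ :=
      eq_empty_of_forall_notMem fun x hx => absurd hx (not_lt.2 ((hg_le x).trans ht1'))
    simp [e1, e2]

theorem ENNReal.four_mul_le_sq_add (a b : ℝ≥0∞) : 4 * (a * b) ≤ (a + b) ^ 2 := by
  rcases eq_or_ne a ∞ with rfl | ha
  · simp
  rcases eq_or_ne b ∞ with rfl | hb
  · simp
  lift a to NNReal using ha
  lift b to NNReal using hb
  norm_cast
  rw [← NNReal.coe_le_coe]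
  push_cast
  nlinarith [sq_nonneg ((a : ℝ) - b)]

/-- The Prékopa-Leindler inequality on the line, for bounded functions. -/
theorem prekopa_leindler_real_of_bounded {f g h : ℝ → ℝ≥0∞} (hf : Measurable f)
    (hg : Measurable g) (hh : Measurable h) (hf1 : ⨆ x, f x ≠ ∞) (hg1 : ⨆ x, g x ≠ ∞)
    (H : ∀ x y, f x * g y ≤ h ((x + y) / 2) ^ 2) :
    (∫⁻ x, f x) * ∫⁻ x, g x ≤ (∫⁻ x, h x) ^ 2 := by
  set a := ⨆ x, f x with ha
  set b := ⨆ x, g x with hb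
  rcases eq_or_ne a 0 with ha0 | ha0
  · have : ∀ x, f x = 0 := fun x => le_antisymm ((le_iSup f x).trans (ha ▸ ha0).le) zero_le
    simp [this]
  rcases eq_or_ne b 0 with hb0 | hb0
  · have : ∀ x, g x = 0 := fun x => le_antisymm ((le_iSup g x).trans (hb ▸ hb0).le) zero_le
    simp [this]
  set s : ℝ≥0∞ := (a * b) ^ (2⁻¹ : ℝ) with hs
  have hs2 : s ^ 2 = a * b := by
    rw [hs, ← ENNReal.rpow_natCast, ← ENNReal.rpow_mul]; norm_num
  have key := lintegral_add_lintegral_le_two_mul (f := fun x => a⁻¹ * f x)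
    (g := fun x => b⁻¹ * g x) (h := fun x => s⁻¹ * h x) (hf.const_mul _) (hg.const_mul _)
    (hh.const_mul _) (by rw [← ENNReal.mul_iSup, ← ha, ENNReal.inv_mul_cancel ha0 hf1])
    (by rw [← ENNReal.mul_iSup, ← hb, ENNReal.inv_mul_cancel hb0 hg1]) (fun x y => by
      rw [mul_pow, ← ENNReal.inv_pow, hs2, ENNReal.mul_inv (Or.inl ha0) (Or.inl hf1)]
      calc a⁻¹ * f x * (b⁻¹ * g y) = a⁻¹ * b⁻¹ * (f x * g y) := by ring
        _ ≤ _ := by gcongr; exact H x y)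
  rw [lintegral_const_mul _ hf, lintegral_const_mul _ hg, lintegral_const_mul _ hh] at key
  set F := ∫⁻ x, f x
  set G := ∫⁻ x, g x
  set I := ∫⁻ x, h x
  have h4 : 4 * (a⁻¹ * F * (b⁻¹ * G)) ≤ 4 * ((a * b)⁻¹ * I ^ 2) := by
    refine (ENNReal.four_mul_le_sq_add _ _).trans ((pow_le_pow_left₀ zero_le key 2).trans_eq ?_)
    rw [mul_pow, mul_pow, ← ENNReal.inv_pow, hs2]; norm_num
  have h5 := (ENNReal.mul_le_mul_iff_right (by norm_num) (by norm_num)).1 h4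
  have hab : a * b ≠ 0 := mul_ne_zero ha0 hb0
  have hab' : a * b ≠ ∞ := ENNReal.mul_ne_top hf1 hg1
  have h6 : (a * b)⁻¹ * (F * G) ≤ (a * b)⁻¹ * I ^ 2 := by
    refine le_trans (le_of_eq ?_) h5
    rw [ENNReal.mul_inv (Or.inl ha0) (Or.inl hf1)]; ring
  exact (ENNReal.mul_le_mul_iff_right (ENNReal.inv_ne_zero.2 hab') (ENNReal.inv_ne_top.2 hab)).1 h6

/-- The Prékopa-Leindler inequality on the line. -/
theorem prekopa_leindler_real {f g h : ℝ → ℝ≥0∞} (hf : Measurable f) (hg : Measurable g)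
    (hh : Measurable h) (H : ∀ x y, f x * g y ≤ h ((x + y) / 2) ^ 2) :
    (∫⁻ x, f x) * ∫⁻ x, g x ≤ (∫⁻ x, h x) ^ 2 := by
  have hmono : ∀ u : ℝ → ℝ≥0∞, Monotone fun (k : ℕ) x => min (u x) k := fun u i j hij x =>
    min_le_min_left _ (by exact_mod_cast hij)
  have hsup : ∀ u : ℝ → ℝ≥0∞, Measurable u → ∫⁻ x, u x = ⨆ k : ℕ, ∫⁻ x, min (u x) k := by
    intro u hu
    rw [← lintegral_iSup (fun k => hu.min measurable_const) (hmono u)]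
    refine lintegral_congr fun x => ?_
    rw [← inf_iSup_eq, ENNReal.iSup_natCast, inf_top_eq]
  rw [hsup f hf, hsup g hg, ENNReal.iSup_mul]
  refine iSup_le fun i => ?_
  rw [ENNReal.mul_iSup]
  refine iSup_le fun j => ?_
  refine prekopa_leindler_real_of_bounded (hf.min measurable_const) (hg.min measurable_const) hh
    ?_ ?_ fun x y => (mul_le_mul' (min_le_left _ _) (min_le_left _ _)).trans (H x y)
  · exact ((iSup_le fun x => min_le_right _ _).trans_lt (ENNReal.natCast_lt_top i)).ne
  · exact ((iSup_le fun x => min_le_right _ _).trans_lt (ENNReal.natCast_lt_top j)).ne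

theorem lintegral_fin_succ_pi {n : ℕ} {f : (Fin (n + 1) → ℝ) → ℝ≥0∞} (hf : Measurable f) :
    ∫⁻ x, f x = ∫⁻ t : ℝ, ∫⁻ y : Fin n → ℝ, f (Fin.cons t y) := by
  have h := (volume_preserving_piFinSuccAbove (fun _ : Fin (n + 1) => ℝ) 0).symm
  rw [← h.lintegral_comp hf, Measure.volume_eq_prod, lintegral_prod]
  · simp [MeasurableEquiv.piFinSuccAbove_symm_apply, Fin.insertNthEquiv]
  · exact (hf.comp h.measurable).aemeasurable

/-- The Prékopa-Leindler inequality (with equal weights). -/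
theorem prekopa_leindler {n : ℕ} {f g h : (Fin n → ℝ) → ℝ≥0∞} (hf : Measurable f)
    (hg : Measurable g) (hh : Measurable h)
    (H : ∀ x y, f x * g y ≤ h (fun i => (x i + y i) / 2) ^ 2) :
    (∫⁻ x, f x) * ∫⁻ x, g x ≤ (∫⁻ x, h x) ^ 2 := by
  induction n with
  | zero =>
    simp only [volume_pi, Measure.pi_of_empty (fun _ : Fin 0 => (volume : Measure ℝ)) 0,
      lintegral_dirac]
    exact (H 0 0).trans (le_of_eq (congrArg (fun z => h z ^ 2) (Subsingleton.elim _ _)))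
  | succ n ih =>
    have hcons : Measurable fun p : ℝ × (Fin n → ℝ) => (Fin.cons p.1 p.2 : Fin (n + 1) → ℝ) := by
      refine measurable_pi_iff.2 fun i => ?_
      refine Fin.cases ?_ (fun i => ?_) i
      · exact measurable_fst
      · exact (measurable_pi_apply i).comp measurable_snd
    rw [lintegral_fin_succ_pi hf, lintegral_fin_succ_pi hg, lintegral_fin_succ_pi hh]
    refine prekopa_leindler_real (hf.comp hcons).lintegral_prod_right'
      (hg.comp hcons).lintegral_prod_right' (hh.comp hcons).lintegral_prod_right' fun s t => ?_
    refine ih (hf.comp (hcons.comp measurable_prodMk_left))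
      (hg.comp (hcons.comp measurable_prodMk_left))
      (hh.comp (hcons.comp measurable_prodMk_left)) fun x y => ?_
    refine (H _ _).trans (le_of_eq (congrArg (fun z => h z ^ 2) ?_))
    funext i
    refine Fin.cases ?_ (fun i => ?_) i <;> simp

/-- If all the points `(x - y) / 2` with `x`, `y` in `G` lie in `H`, then the volume of `H` is at
least that of `G`. -/
theorem volume_le_of_half_sub_mem {n : ℕ} {G H : Set (Fin n → ℝ)} (hG : MeasurableSet G)
    (hH : MeasurableSet H) (h : ∀ x ∈ G, ∀ y ∈ G, (fun i => (x i - y i) / 2) ∈ H) :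
    volume G ≤ volume H := by
  have hG' : MeasurableSet (-G) := hG.neg
  have key := prekopa_leindler (f := G.indicator 1) (g := (-G).indicator 1) (h := H.indicator 1)
    (measurable_one.indicator hG) (measurable_one.indicator hG') (measurable_one.indicator hH)
    (fun x y => by
      by_cases hx : x ∈ G
      · by_cases hy : -y ∈ G
        · have h1 := h x hx _ hy
          simp only [Pi.neg_apply, sub_neg_eq_add] at h1
          simp [hx, hy, h1]
        · simp [hy]
      · simp [hx])
  rw [lintegral_indicator_one hG, lintegral_indicator_one hG', lintegral_indicator_one hH,
    Measure.measure_neg, ← sq] at key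
  exact (ENNReal.pow_le_pow_left_iff two_ne_zero).1 key

/-! ### Volumes of convex hulls of finitely many points -/

theorem Convex.volume_eq_ediam {A : Set ℝ} (hA : Convex ℝ A) : volume A = ediam A := by
  refine le_antisymm (Real.volume_le_diam A) (ediam_le fun x hx y hy => ?_)
  rw [edist_comm, edist_dist, Real.dist_eq, ← Real.volume_interval, ← segment_eq_uIcc]
  exact measure_mono (hA.segment_subset hx hy)

theorem convexHull_range_eq_image_stdSimplex {ι E : Type*} [Fintype ι] [AddCommGroup E]
    [Module ℝ E] (x : ι → E) :
    convexHull ℝ (range x) = (fun w : ι → ℝ => ∑ i, w i • x i) '' stdSimplex ℝ ι := by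
  classical
  have h : (fun w : ι → ℝ => ∑ i, w i • x i) = Fintype.linearCombination ℝ x := by
    ext w; simp [Fintype.linearCombination_apply]
  rw [h, ← convexHull_rangle_single_eq_stdSimplex, LinearMap.image_convexHull, ← range_comp]
  congr 2
  ext i
  simp [Fintype.linearCombination_apply_single]

theorem isClosed_setOf_mem_convexHull_range {ι E : Type*} [Fintype ι] [AddCommGroup E]
    [Module ℝ E] [TopologicalSpace E] [IsTopologicalAddGroup E] [ContinuousSMul ℝ E] [T2Space E] :
    IsClosed {p : (ι → E) × E | p.2 ∈ convexHull ℝ (range p.1)} := by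
  have h : {p : (ι → E) × E | p.2 ∈ convexHull ℝ (range p.1)} =
      Prod.snd '' {q : stdSimplex ℝ ι × ((ι → E) × E) |
        ∑ i, (q.1 : ι → ℝ) i • q.2.1 i = q.2.2} := by
    ext p
    constructor
    · intro hp
      obtain ⟨w, hw, h⟩ := (convexHull_range_eq_image_stdSimplex p.1).subset hp
      exact ⟨(⟨w, hw⟩, p), h, rfl⟩
    · rintro ⟨⟨w, q⟩, h, rfl⟩
      exact (convexHull_range_eq_image_stdSimplex q.1).superset ⟨w, w.2, h⟩
  rw [h]
  refine isClosedMap_snd_of_compactSpace _ (isClosed_eq ?_ ?_)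
  · refine continuous_finsetSum _ fun i _ => ?_
    exact ((continuous_apply i).comp (continuous_subtype_val.comp continuous_fst)).smul
      ((continuous_apply i).comp (continuous_fst.comp continuous_snd))
  · exact continuous_snd.comp continuous_snd

theorem measurable_measure_convexHull_range {ι E : Type*} [Fintype ι] [NormedAddCommGroup E]
    [NormedSpace ℝ E] [FiniteDimensional ℝ E] [MeasurableSpace E] [BorelSpace E]
    (μ : Measure E) [SFinite μ] :
    Measurable fun x : ι → E => μ (convexHull ℝ (range x)) := by
  have := FiniteDimensional.proper_real E
  exact measurable_measure_prodMk_left isClosed_setOf_mem_convexHull_range.measurableSet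

section ProductSpace

variable {F : Type*} [NormedAddCommGroup F] [NormedSpace ℝ F] [FiniteDimensional ℝ F]
  [MeasureSpace F] [BorelSpace F] [SFinite (volume : Measure F)]

/-- The section of a set in `ℝ × F` over a point of `F`. -/
def fiber {F : Type*} (L : Set (ℝ × F)) (y : F) : Set ℝ := (fun t => (t, y)) ⁻¹' L

theorem Convex.fiber {F : Type*} [AddCommGroup F] [Module ℝ F] {L : Set (ℝ × F)}
    (hL : Convex ℝ L) (y : F) : Convex ℝ (fiber L y) := by
  intro s hs t ht a b ha hb hab
  have := hL hs ht ha hb hab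
  simpa [_root_.fiber, ← add_smul, hab] using this

theorem MeasurableSet.fiber {F : Type*} [MeasurableSpace F] {L : Set (ℝ × F)}
    (hL : MeasurableSet L) (y : F) : MeasurableSet (fiber L y) :=
  hL.preimage measurable_prodMk_right

theorem volume_eq_lintegral_fiber {F : Type*} [MeasureSpace F] [SFinite (volume : Measure F)]
    {L : Set (ℝ × F)} (hL : MeasurableSet L) : volume L = ∫⁻ y, volume (fiber L y) :=
  Measure.prod_apply_symm hL

theorem measurable_volume_fiber {F : Type*} [MeasurableSpace F]
    {L : Set (ℝ × F)} (hL : MeasurableSet L) : Measurable fun y => volume (fiber L y) :=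
  measurable_measure_prodMk_right hL

/-- For fixed `y`, the volume of the convex hull of the points `(t i, y i)` is a midpoint convex
and even function of `t`. -/
theorem two_mul_volume_convexHull_half_sub_le {ι : Type*} [Fintype ι] (y : ι → F) (s t : ι → ℝ) :
    2 * volume (convexHull ℝ (range fun i => ((s i - t i) / 2, y i))) ≤
      volume (convexHull ℝ (range fun i => (s i, y i))) +
        volume (convexHull ℝ (range fun i => (t i, y i))) := by
  have hmeas : ∀ t : ι → ℝ, MeasurableSet (convexHull ℝ (range fun i => (t i, y i))) := fun t =>
    (finite_range _).isClosed_convexHull ℝ |>.measurableSet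
  have hmem : ∀ (t : ι → ℝ) (z : F) (r : ℝ),
      r ∈ fiber (convexHull ℝ (range fun i => (t i, y i))) z ↔
        ∃ w ∈ stdSimplex ℝ ι, ∑ i, w i * t i = r ∧ ∑ i, w i • y i = z := by
    intro t z r
    simp [fiber, convexHull_range_eq_image_stdSimplex, Prod.ext_iff, Prod.fst_sum, Prod.snd_sum]
  rw [volume_eq_lintegral_fiber (hmeas _), volume_eq_lintegral_fiber (hmeas s),
    volume_eq_lintegral_fiber (hmeas t), ← lintegral_const_mul' _ _ (by simp),
    ← lintegral_add_left (measurable_volume_fiber (hmeas s))]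
  refine lintegral_mono fun z => ?_
  simp only [((convex_convexHull ℝ _).fiber z).volume_eq_ediam]
  suffices h : ediam (fiber (convexHull ℝ (range fun i => ((s i - t i) / 2, y i))) z) ≤
      (ediam (fiber (convexHull ℝ (range fun i => (s i, y i))) z) +
        ediam (fiber (convexHull ℝ (range fun i => (t i, y i))) z)) / 2 by
    have := mul_le_mul_right h 2
    rwa [ENNReal.mul_div_cancel (by simp) (by simp)] at this
  refine ediam_le fun p hp q hq => ?_
  obtain ⟨w, hw, rfl, hwz⟩ := (hmem _ z p).1 hp
  obtain ⟨v, hv, rfl, hvz⟩ := (hmem _ z q).1 hq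
  have h1 := edist_le_ediam_of_mem ((hmem s z _).2 ⟨w, hw, rfl, hwz⟩)
    ((hmem s z _).2 ⟨v, hv, rfl, hvz⟩)
  have h2 := edist_le_ediam_of_mem ((hmem t z _).2 ⟨w, hw, rfl, hwz⟩)
    ((hmem t z _).2 ⟨v, hv, rfl, hvz⟩)
  refine le_trans ?_ (ENNReal.div_le_div_right (add_le_add h1 h2) 2)
  rw [edist_dist, edist_dist, edist_dist, ← ENNReal.ofReal_add dist_nonneg dist_nonneg,
    ← ENNReal.ofReal_ofNat, ← ENNReal.ofReal_div_of_pos (by norm_num)]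
  refine ENNReal.ofReal_le_ofReal ?_
  simp only [Real.dist_eq]
  have e : ∀ w : ι → ℝ, ∑ i, w i * ((s i - t i) / 2) = (∑ i, w i * s i - ∑ i, w i * t i) / 2 := by
    intro w
    rw [← Finset.sum_sub_distrib, Finset.sum_div]
    exact Finset.sum_congr rfl fun i _ => by ring
  rw [e, e, ← sub_div, abs_div, abs_two]
  gcongr
  rw [sub_sub_sub_comm]
  exact abs_sub _ _

/-! ### Steiner symmetrization -/

/-- The Steiner symmetral of a set in `ℝ × F` with respect to `{0} × F`. -/
def steiner {F : Type*} (L : Set (ℝ × F)) : Set (ℝ × F) :=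
  {p | 0 < volume (fiber L p.2) ∧ 2 * ‖p.1‖ₑ ≤ volume (fiber L p.2)}

theorem measurableSet_steiner {F : Type*} [MeasurableSpace F] {L : Set (ℝ × F)}
    (hL : MeasurableSet L) : MeasurableSet (steiner L) := by
  have h := (measurable_volume_fiber hL).comp (measurable_snd : Measurable (Prod.snd : ℝ × F → F))
  exact (measurableSet_lt measurable_const h).inter
    (measurableSet_le (measurable_fst.enorm.const_mul 2) h)

theorem volume_setOf_two_mul_enorm_le (c : ℝ≥0∞) : volume {t : ℝ | 2 * ‖t‖ₑ ≤ c} = c := by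
  rcases eq_or_ne c ∞ with rfl | hc
  · simp
  · have : {t : ℝ | 2 * ‖t‖ₑ ≤ c} = closedBall 0 (c.toReal / 2) := by
      ext t
      rw [mem_ofPred_eq, mem_closedBall, dist_zero_right, ← ENNReal.toReal_le_toReal
        (ENNReal.mul_ne_top (by simp) (by simp)) hc]
      simp only [ENNReal.toReal_mul, ENNReal.toReal_ofNat, toReal_enorm]
      constructor <;> intro h <;> linarith
    rw [this, Real.volume_closedBall, mul_div_cancel₀ _ two_ne_zero, ENNReal.ofReal_toReal hc]

theorem volume_fiber_steiner {F : Type*} (L : Set (ℝ × F)) (y : F) :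
    volume (fiber (steiner L) y) = volume (fiber L y) := by
  rcases eq_or_ne (volume (fiber L y)) 0 with h | h
  · simp [fiber, steiner] at h ⊢
    simp [h]
  · have : fiber (steiner L) y = {t : ℝ | 2 * ‖t‖ₑ ≤ volume (fiber L y)} := by
      ext t
      simp [fiber, steiner] at h ⊢
      simp [pos_iff_ne_zero, h]
    rw [this, volume_setOf_two_mul_enorm_le]

theorem volume_steiner {F : Type*} [MeasureSpace F] [SFinite (volume : Measure F)]
    {L : Set (ℝ × F)} (hL : MeasurableSet L) :
    volume (steiner L) = volume L := by
  rw [volume_eq_lintegral_fiber (measurableSet_steiner hL), volume_eq_lintegral_fiber hL]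
  exact lintegral_congr (volume_fiber_steiner L)

/-- The Brunn-Minkowski inequality for sections. -/
theorem Convex.volume_fiber_le {F : Type*} [AddCommGroup F] [Module ℝ F] [MeasurableSpace F]
    {L : Set (ℝ × F)} (hL : Convex ℝ L) (hLm : MeasurableSet L)
    {y z : F} (hy : volume (_root_.fiber L y) ≠ 0) (hz : volume (_root_.fiber L z) ≠ 0) {a b : ℝ}
    (ha : 0 < a) (hb : 0 < b) (hab : a + b = 1) :
    ENNReal.ofReal a * volume (_root_.fiber L y) + ENNReal.ofReal b * volume (_root_.fiber L z) ≤
      volume (_root_.fiber L (a • y + b • z)) := by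
  have hscale : ∀ {c : ℝ}, 0 < c → ∀ A : Set ℝ,
      volume ((fun x => c⁻¹ • x) ⁻¹' A) = ENNReal.ofReal c * volume A := by
    intro c hc A
    rw [Measure.addHaar_preimage_smul _ (inv_ne_zero hc.ne')]
    simp [abs_of_pos hc]
  rw [← hscale ha, ← hscale hb]
  refine volume_add_volume_le_of_add_mem ((hLm.fiber y).preimage (measurable_const_smul _))
    ((hLm.fiber z).preimage (measurable_const_smul _)) ?_ ?_ fun s hs t ht => ?_
  · obtain ⟨s, hs⟩ := nonempty_of_measure_ne_zero hy
    exact ⟨a * s, by simpa [ha.ne'] using hs⟩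
  · obtain ⟨s, hs⟩ := nonempty_of_measure_ne_zero hz
    exact ⟨b * s, by simpa [hb.ne'] using hs⟩
  · have := hL hs ht ha.le hb.le hab
    simpa [_root_.fiber, ha.ne', hb.ne'] using this

theorem Convex.steiner {F : Type*} [AddCommGroup F] [Module ℝ F] [MeasurableSpace F]
    {L : Set (ℝ × F)} (hL : Convex ℝ L) (hLm : MeasurableSet L) :
    Convex ℝ (steiner L) := by
  refine convex_iff_forall_pos.2 ?_
  rintro ⟨s, y⟩ ⟨hy, hs⟩ ⟨t, z⟩ ⟨hz, ht⟩ a b ha hb hab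
  have key := hL.volume_fiber_le hLm hy.ne' hz.ne' ha hb hab
  have ha' : 0 < ENNReal.ofReal a := ENNReal.ofReal_pos.2 ha
  refine ⟨lt_of_lt_of_le ?_ key, le_trans ?_ key⟩
  · exact (ENNReal.mul_pos ha'.ne' hy.ne').trans_le le_self_add
  · calc 2 * ‖a • s + b • t‖ₑ ≤ 2 * (‖a • s‖ₑ + ‖b • t‖ₑ) := by gcongr; exact enorm_add_le _ _
      _ = ENNReal.ofReal a * (2 * ‖s‖ₑ) + ENNReal.ofReal b * (2 * ‖t‖ₑ) := by
        rw [enorm_smul, enorm_smul, Real.enorm_of_nonneg ha.le, Real.enorm_of_nonneg hb.le]; ring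
      _ ≤ _ := by gcongr

/-- Configurations of points in `L` whose convex hull has volume in `D`. -/
def hullVolumeIn {E : Type*} [AddCommGroup E] [Module ℝ E] [MeasureSpace E] (N : ℕ)
    (D : Set ℝ≥0∞) (L : Set E) : Set (Fin N → E) :=
  {x | (∀ i, x i ∈ L) ∧ volume (convexHull ℝ (range x)) ∈ D}

theorem measurableSet_hullVolumeIn {E : Type*} [NormedAddCommGroup E]
    [NormedSpace ℝ E] [FiniteDimensional ℝ E] [MeasureSpace E] [BorelSpace E]
    [SFinite (volume : Measure E)] (N : ℕ)
    {D : Set ℝ≥0∞} (hD : IsLowerSet D) {L : Set E} (hL : MeasurableSet L) :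
    MeasurableSet (hullVolumeIn N D L) := by
  have h : hullVolumeIn N D L = (univ.pi fun _ => L) ∩
      (fun x : Fin N → E => volume (convexHull ℝ (range x))) ⁻¹' D := by
    ext x
    simp [hullVolumeIn]
  rw [h]
  exact (MeasurableSet.univ_pi fun _ => hL).inter
    (hD.ordConnected.measurableSet.preimage (measurable_measure_convexHull_range volume))

/-- Steiner symmetrization increases the measure of the set of configurations whose convex hull
has small volume. -/
theorem volume_hullVolumeIn_le_steiner [SigmaFinite (volume : Measure F)] {N : ℕ} {D : Set ℝ≥0∞}
    (hD : IsLowerSet D) {L : Set (ℝ × F)} (hL : Convex ℝ L) (hLm : MeasurableSet L) :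
    volume (hullVolumeIn N D L) ≤ volume (hullVolumeIn N D (steiner L)) := by
  have hT := (volume_measurePreserving_arrowProdEquivProdArrow ℝ F (Fin N)).symm
  have hG := measurableSet_hullVolumeIn N hD hLm
  have hH := measurableSet_hullVolumeIn N hD (measurableSet_steiner hLm)
  rw [← hT.measure_preimage hG.nullMeasurableSet, ← hT.measure_preimage hH.nullMeasurableSet,
    Measure.volume_eq_prod, Measure.prod_apply_symm (hG.preimage hT.measurable),
    Measure.prod_apply_symm (hH.preimage hT.measurable)]
  refine lintegral_mono fun y => ?_
  by_cases hy : ∃ i, volume (fiber L (y i)) = 0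
  · obtain ⟨i, hi⟩ := hy
    refine le_trans (le_of_eq ?_) zero_le
    refine measure_mono_null (t := univ.pi fun i => fiber L (y i)) (fun t ht j _ => ht.1 j) ?_
    rw [volume_pi_pi]
    exact Finset.prod_eq_zero (Finset.mem_univ i) hi
  push Not at hy
  refine volume_le_of_half_sub_mem ((hG.preimage hT.measurable).preimage measurable_prodMk_right)
    ((hH.preimage hT.measurable).preimage measurable_prodMk_right) fun s hs t ht => ⟨fun i => ?_, ?_⟩
  · refine ⟨pos_iff_ne_zero.2 (hy i), ?_⟩
    have h1 := edist_le_ediam_of_mem (show s i ∈ fiber L (y i) from hs.1 i)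
      (show t i ∈ fiber L (y i) from ht.1 i)
    rw [← (hL.fiber _).volume_eq_ediam] at h1
    refine le_trans (le_of_eq ?_) h1
    change 2 * ‖(s i - t i) / 2‖ₑ = _
    rw [edist_eq_enorm_sub, div_eq_mul_inv, enorm_mul, mul_comm ‖s i - t i‖ₑ, ← mul_assoc,
      show (2 : ℝ≥0∞) = ‖(2 : ℝ)‖ₑ by simp [Real.enorm_eq_ofReal], ← enorm_mul]
    simp
  · have h2 := two_mul_volume_convexHull_half_sub_le y s t
    rcases le_total (volume (convexHull ℝ (range fun i => (s i, y i))))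
      (volume (convexHull ℝ (range fun i => (t i, y i)))) with h | h
    · refine hD ?_ ht.2
      refine (ENNReal.mul_le_mul_iff_right (a := 2) (by simp) (by simp)).1 (h2.trans ?_)
      rw [two_mul]
      exact add_le_add_left h _
    · refine hD ?_ hs.2
      refine (ENNReal.mul_le_mul_iff_right (a := 2) (by simp) (by simp)).1 (h2.trans ?_)
      rw [two_mul]
      exact add_le_add_right h _

end ProductSpace

section RoundBall

variable {F : Type*} [NormedAddCommGroup F]

/-- The ball of radius `r` about the origin for the Euclidean product norm on `ℝ × F`. -/
def roundBall (F : Type*) [NormedAddCommGroup F] (r : ℝ) : Set (ℝ × F) :=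
  {p | p.1 ^ 2 + ‖p.2‖ ^ 2 ≤ r ^ 2}

theorem fiber_roundBall_of_le {r : ℝ} {y : F} (h : ‖y‖ ^ 2 ≤ r ^ 2) :
    fiber (roundBall F r) y =
      {t | 2 * ‖t‖ₑ ≤ ENNReal.ofReal (2 * √(r ^ 2 - ‖y‖ ^ 2))} := by
  ext t
  simp only [fiber, roundBall, mem_preimage, mem_ofPred_eq]
  rw [Real.enorm_eq_ofReal_abs, ENNReal.ofReal_mul (by norm_num), ENNReal.ofReal_ofNat,
    ENNReal.mul_le_mul_iff_right (by simp) (by simp),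
    ENNReal.ofReal_le_ofReal_iff (Real.sqrt_nonneg _), Real.le_sqrt (by positivity), sq_abs]
  · constructor <;> intro <;> linarith
  · exact sub_nonneg.2 h

theorem fiber_roundBall_of_lt {r : ℝ} {y : F} (h : r ^ 2 < ‖y‖ ^ 2) :
    fiber (roundBall F r) y = ∅ := by
  ext t
  simp only [fiber, roundBall, mem_preimage, mem_ofPred_eq, mem_empty_iff_false, iff_false, not_le]
  nlinarith [sq_nonneg t]

theorem measurableSet_roundBall [MeasurableSpace F] [BorelSpace F] (r : ℝ) :
    MeasurableSet (roundBall F r) :=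
  measurableSet_le ((measurable_fst.pow_const 2).add (measurable_snd.norm.pow_const 2))
    measurable_const

theorem steiner_subset_roundBall {L : Set (ℝ × F)} {r : ℝ} (h : L ⊆ roundBall F r) :
    steiner L ⊆ roundBall F r := by
  rintro ⟨t, y⟩ ⟨hy, ht⟩
  have hsub : fiber L y ⊆ fiber (roundBall F r) y := fun s hs => h hs
  rcases le_or_gt (‖y‖ ^ 2) (r ^ 2) with hyr | hyr
  · change t ∈ fiber (roundBall F r) y
    have := (measure_mono hsub).trans_eq (congrArg volume (fiber_roundBall_of_le hyr))
    rw [volume_setOf_two_mul_enorm_le] at this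
    rw [fiber_roundBall_of_le hyr]
    exact ht.trans this
  · rw [fiber_roundBall_of_lt hyr, subset_empty_iff] at hsub
    simp [hsub] at hy

/-- Steiner symmetrization increases the volume of the intersection with a centered ball, by at
least the measure of the points of `L \ B` whose translate by `(s, 0)` lies in `B \ L`. -/
theorem volume_inter_add_le_volume_steiner_inter [MeasureSpace F] [BorelSpace F]
    [SFinite (volume : Measure F)] {L : Set (ℝ × F)} (hL : MeasurableSet L) (r s : ℝ) :
    volume (L ∩ roundBall F r) +
        volume {p | p ∈ L \ roundBall F r ∧ p + (s, 0) ∈ roundBall F r \ L} ≤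
      volume (steiner L ∩ roundBall F r) := by
  set B := roundBall F r with hB
  have hBm : MeasurableSet B := measurableSet_roundBall r
  have hadd : Measurable fun p : ℝ × F => p + (s, 0) :=
    (measurable_fst.add_const s).prodMk (by simpa using measurable_snd)
  have hDm : MeasurableSet {p | p ∈ L \ B ∧ p + (s, 0) ∈ B \ L} :=
    (hL.diff hBm).inter ((hBm.diff hL).preimage hadd)
  rw [volume_eq_lintegral_fiber (hL.inter hBm), volume_eq_lintegral_fiber hDm,
    volume_eq_lintegral_fiber ((measurableSet_steiner hL).inter hBm),
    ← lintegral_add_left (measurable_volume_fiber (hL.inter hBm))]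
  refine lintegral_mono fun y => ?_
  have hsplit : fiber (L ∩ B) y = fiber L y ∩ fiber B y := rfl
  have hsplit' : fiber (steiner L ∩ B) y = fiber (steiner L) y ∩ fiber B y := rfl
  have hD : fiber {p | p ∈ L \ B ∧ p + (s, 0) ∈ B \ L} y =
      (fiber L y \ fiber B y) ∩ (fun t => t + s) ⁻¹' (fiber B y \ fiber L y) := by
    ext t
    simp [fiber]
  rw [hsplit, hsplit', hD]
  have h1 : volume (fiber L y ∩ fiber B y) + volume ((fiber L y \ fiber B y) ∩
      (fun t => t + s) ⁻¹' (fiber B y \ fiber L y)) ≤ volume (fiber L y) := by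
    rw [← measure_inter_add_sdiff (fiber L y) (hBm.fiber y)]
    gcongr
    exact inter_subset_left
  have h2 : volume (fiber L y ∩ fiber B y) + volume ((fiber L y \ fiber B y) ∩
      (fun t => t + s) ⁻¹' (fiber B y \ fiber L y)) ≤ volume (fiber B y) := by
    rw [← measure_inter_add_sdiff (fiber B y) (hL.fiber y), inter_comm (fiber B y)]
    refine add_le_add_right ?_ _
    rw [← measure_preimage_add_right volume s (fiber B y \ fiber L y)]
    exact measure_mono inter_subset_right
  rcases eq_or_ne (volume (fiber L y)) 0 with h0 | h0
  · exact h1.trans (h0.le.trans zero_le)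
  have hst : fiber (steiner L) y = {t : ℝ | 2 * ‖t‖ₑ ≤ volume (fiber L y)} := by
    ext t
    simp [fiber, steiner] at h0 ⊢
    simp [pos_iff_ne_zero, h0]
  rcases le_or_gt (‖y‖ ^ 2) (r ^ 2) with hyr | hyr
  · have hBy := fiber_roundBall_of_le hyr
    rcases le_total (volume (fiber L y)) (ENNReal.ofReal (2 * √(r ^ 2 - ‖y‖ ^ 2))) with h | h
    · have hsub : fiber (steiner L) y ⊆ fiber B y := by
        rw [hst, hB, hBy]
        exact fun t ht => le_trans ht h
      rw [inter_eq_left.2 hsub, volume_fiber_steiner]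
      exact h1
    · have hsub : fiber B y ⊆ fiber (steiner L) y := by
        rw [hst, hB, hBy]
        exact fun t ht => le_trans ht h
      rw [inter_eq_right.2 hsub]
      exact h2
  · rw [hB, fiber_roundBall_of_lt hyr]
    simp

end RoundBall

/-! ### Transfer to Euclidean space -/

/-- A measure preserving linear isomorphism `ℝⁿ⁺¹ ≃ ℝ × ℝⁿ` respecting Euclidean norms and mapping
a given nonzero vector to the first axis. -/
theorem exists_measurePreserving_equiv_prod {m : ℕ} {w : EuclideanSpace ℝ (Fin (m + 1))}
    (hw : w ≠ 0) :
    ∃ e : EuclideanSpace ℝ (Fin (m + 1)) ≃L[ℝ] ℝ × EuclideanSpace ℝ (Fin m),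
      MeasurePreserving e volume volume ∧ (∀ x, (e x).1 ^ 2 + ‖(e x).2‖ ^ 2 = ‖x‖ ^ 2) ∧
        e w = (‖w‖, 0) := by
  set W := WithLp 2 (ℝ × EuclideanSpace ℝ (Fin m))
  have basis : ∀ {V : Type} [NormedAddCommGroup V] [InnerProductSpace ℝ V]
      [FiniteDimensional ℝ V], Module.finrank ℝ V = m + 1 → ∀ v : V, ‖v‖ = 1 →
      ∃ b : OrthonormalBasis (Fin (m + 1)) ℝ V, b 0 = v := by
    intro V _ _ _ hV v hv
    have hon : Orthonormal ℝ (({0} : Set (Fin (m + 1))).domRestrict fun _ => v) := by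
      refine ⟨fun _ => hv, fun i j hij => absurd (Subsingleton.elim i j) hij⟩
    obtain ⟨b, hb⟩ := hon.exists_orthonormalBasis_extension_of_card_eq (by simp [hV])
    exact ⟨b, hb 0 rfl⟩
  obtain ⟨b, hb⟩ := basis (V := EuclideanSpace ℝ (Fin (m + 1))) (by simp) (‖w‖⁻¹ • w)
    (by rw [norm_smul, norm_inv, norm_norm, inv_mul_cancel₀ (norm_ne_zero_iff.2 hw)])
  have hW : Module.finrank ℝ W = m + 1 := by
    rw [(WithLp.linearEquiv 2 ℝ (ℝ × EuclideanSpace ℝ (Fin m))).finrank_eq]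
    simp [add_comm]
  obtain ⟨b', hb'⟩ := basis (V := W) hW (WithLp.toLp 2 (1, 0)) (by
    rw [WithLp.prod_norm_eq_of_L2]; simp)
  set T := b.equiv b' (Equiv.refl _)
  refine ⟨T.toContinuousLinearEquiv.trans
    (WithLp.prodContinuousLinearEquiv 2 ℝ ℝ (EuclideanSpace ℝ (Fin m))), ?_, fun x => ?_, ?_⟩
  · exact (WithLp.volume_preserving_ofLp ℝ (EuclideanSpace ℝ (Fin m))).comp
      (T.measurePreserving)
  · rw [← T.norm_map x, WithLp.prod_norm_sq_eq_of_L2, Real.norm_eq_abs, sq_abs]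
    rfl
  · have h1 : T (‖w‖⁻¹ • w) = WithLp.toLp 2 (1, 0) := by
      rw [← hb, ← hb', OrthonormalBasis.equiv_apply_basis]; rfl
    have h2 : T w = ‖w‖ • WithLp.toLp 2 (1, 0) := by
      rw [← h1, ← T.map_smul, smul_smul, mul_inv_cancel₀ (norm_ne_zero_iff.2 hw), one_smul]
    have h3 : WithLp.prodContinuousLinearEquiv 2 ℝ ℝ (EuclideanSpace ℝ (Fin m))
      (WithLp.toLp 2 (1, 0)) = (1, 0) := rfl
    simp [h2, h3]

theorem volume_hullVolumeIn_preimage {E E' : Type*} [NormedAddCommGroup E] [NormedSpace ℝ E]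
    [FiniteDimensional ℝ E] [MeasureSpace E] [BorelSpace E] [SigmaFinite (volume : Measure E)]
    [NormedAddCommGroup E'] [NormedSpace ℝ E']
    [FiniteDimensional ℝ E'] [MeasureSpace E'] [BorelSpace E']
    [SigmaFinite (volume : Measure E')] {e : E ≃L[ℝ] E'}
    (he : MeasurePreserving e volume volume) {N : ℕ} {D : Set ℝ≥0∞} (hD : IsLowerSet D)
    {L : Set E'} (hL : MeasurableSet L) :
    volume (hullVolumeIn N D (e ⁻¹' L)) = volume (hullVolumeIn N D L) := by
  have hpi : MeasurePreserving (fun (x : Fin N → E) i => e (x i)) volume volume :=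
    volume_preserving_pi fun _ => he
  rw [← hpi.measure_preimage (measurableSet_hullVolumeIn N hD hL).nullMeasurableSet]
  congr 1
  ext x
  have h : volume (convexHull ℝ (range fun i => e (x i))) = volume (convexHull ℝ (range x)) := by
    have h1 : range x = e ⁻¹' range fun i => e (x i) := by
      ext z; simp
    have h2 : convexHull ℝ (range x) = e ⁻¹' convexHull ℝ (range fun i => e (x i)) := by
      have := LinearMap.image_convexHull (e : E →ₗ[ℝ] E') (range x)
      rw [← range_comp] at this
      have h3 : (range fun i => e (x i)) = range ((e : E →ₗ[ℝ] E') ∘ x) := rfl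
      rw [h3, ← this]
      exact (preimage_image_eq _ e.injective).symm
    rw [h2]
    exact (he.measure_preimage
      ((finite_range _).isClosed_convexHull ℝ).measurableSet.nullMeasurableSet).symm
  simp [hullVolumeIn, h]

/-- Steiner symmetrization in Euclidean space in the direction of a vector `w`. -/
theorem exists_symmetral {m N : ℕ} {D : Set ℝ≥0∞} (hD : IsLowerSet D)
    {L : Set (EuclideanSpace ℝ (Fin (m + 1)))} (hL : Convex ℝ L) (hLm : MeasurableSet L) {R r : ℝ}
    (hR : 0 ≤ R) (hr : 0 ≤ r) (hLR : L ⊆ closedBall 0 R) {w : EuclideanSpace ℝ (Fin (m + 1))}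
    (hw : w ≠ 0) :
    ∃ L' : Set (EuclideanSpace ℝ (Fin (m + 1))), Convex ℝ L' ∧ MeasurableSet L' ∧
      L' ⊆ closedBall 0 R ∧ volume L' = volume L ∧
      volume (hullVolumeIn N D L) ≤ volume (hullVolumeIn N D L') ∧
      volume (L ∩ closedBall 0 r) +
          volume {p | p ∈ L \ closedBall 0 r ∧ p + w ∈ closedBall 0 r \ L} ≤
        volume (L' ∩ closedBall 0 r) := by
  obtain ⟨e, he, hnorm, hew⟩ := exists_measurePreserving_equiv_prod hw
  have hball : ∀ {ρ : ℝ}, 0 ≤ ρ → closedBall 0 ρ = e ⁻¹' roundBall (EuclideanSpace ℝ (Fin m)) ρ := by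
    intro ρ hρ
    ext x
    rw [mem_closedBall, dist_zero_right, mem_preimage, roundBall, mem_ofPred_eq, hnorm,
      sq_le_sq₀ (norm_nonneg _) hρ]
  obtain ⟨M, hM, hMm, rfl⟩ : ∃ M, Convex ℝ M ∧ MeasurableSet M ∧ L = e ⁻¹' M :=
    ⟨e.symm ⁻¹' L, hL.linear_preimage (e.symm : ℝ × EuclideanSpace ℝ (Fin m) →ₗ[ℝ] _),
      hLm.preimage e.symm.continuous.measurable, by ext; simp⟩
  have hSm := measurableSet_steiner hMm
  have hMR : M ⊆ roundBall (EuclideanSpace ℝ (Fin m)) R := by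
    intro p hp
    have := hLR (show e.symm p ∈ e ⁻¹' M by simpa using hp)
    rw [hball hR] at this
    simpa using this
  have hvol : ∀ {A : Set (ℝ × EuclideanSpace ℝ (Fin m))}, MeasurableSet A →
      volume (e ⁻¹' A) = volume A := fun hA => he.measure_preimage hA.nullMeasurableSet
  refine ⟨e ⁻¹' steiner M, (hM.steiner hMm).linear_preimage e.toLinearMap,
    hSm.preimage e.continuous.measurable, ?_, ?_, ?_, ?_⟩
  · rw [hball hR]
    exact preimage_mono (steiner_subset_roundBall hMR)
  · rw [hvol hSm, hvol hMm, volume_steiner hMm]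
  · rw [volume_hullVolumeIn_preimage he hD hMm, volume_hullVolumeIn_preimage he hD hSm]
    exact volume_hullVolumeIn_le_steiner hD hM hMm
  · have hBm : MeasurableSet (roundBall (EuclideanSpace ℝ (Fin m)) r) := measurableSet_roundBall r
    rw [hball hr, ← preimage_inter, ← preimage_inter, hvol (hMm.inter hBm),
      hvol (hSm.inter hBm)]
    refine le_trans (add_le_add_right ?_ _) (volume_inter_add_le_volume_steiner_inter hMm r ‖w‖)
    have hadd : Measurable fun p : ℝ × EuclideanSpace ℝ (Fin m) => p + (‖w‖, 0) :=
      (measurable_fst.add_const _).prodMk (by simpa using measurable_snd)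
    rw [← hvol (A := {p : ℝ × EuclideanSpace ℝ (Fin m) |
        p ∈ M \ roundBall (EuclideanSpace ℝ (Fin m)) r ∧ p + (‖w‖, 0) ∈ roundBall (EuclideanSpace ℝ (Fin m)) r \ M})
      ((hMm.diff hBm).inter ((hBm.diff hMm).preimage hadd))]
    refine measure_mono fun p hp => ?_
    simpa [hew] using hp

/-! ### Convergence to the ball -/

theorem lintegral_volume_setOf_mem_and_add_mem {E : Type*} [AddCommGroup E] [MeasurableSpace E]
    [MeasurableAdd₂ E] (μ : Measure E) [SFinite μ] [μ.IsAddLeftInvariant] {A A' : Set E}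
    (hA : MeasurableSet A) (hA' : MeasurableSet A') :
    ∫⁻ w, μ {p | p ∈ A ∧ p + w ∈ A'} ∂μ = μ A * μ A' := by
  have hT : MeasurableSet {q : E × E | q.2 ∈ A ∧ q.2 + q.1 ∈ A'} :=
    (hA.preimage measurable_snd).inter (hA'.preimage (measurable_snd.add measurable_fst))
  have h1 := Measure.prod_apply (μ := μ) (ν := μ) hT
  have h2 := Measure.prod_apply_symm (μ := μ) (ν := μ) hT
  refine (h1.symm.trans h2).trans ?_
  have h3 : ∀ p, μ ((fun w => (w, p)) ⁻¹' {q : E × E | q.2 ∈ A ∧ q.2 + q.1 ∈ A'}) =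
      A.indicator (fun _ => μ A') p := by
    intro p
    by_cases hp : p ∈ A
    · have : (fun w => (w, p)) ⁻¹' {q : E × E | q.2 ∈ A ∧ q.2 + q.1 ∈ A'} =
          (fun w => p + w) ⁻¹' A' := by ext; simp [hp]
      rw [this, measure_preimage_add, indicator_of_mem hp]
    · simp [hp]
  rw [lintegral_congr h3, lintegral_indicator_const hA, mul_comm]

/-- Some translation carries a definite amount of `A` into `A'`. -/
theorem exists_le_volume_setOf_mem_and_add_mem {E : Type*} [NormedAddCommGroup E]
    [NormedSpace ℝ E] [FiniteDimensional ℝ E] [MeasurableSpace E] [BorelSpace E] (μ : Measure E)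
    [μ.IsAddHaarMeasure] {A A' : Set E} (hA : MeasurableSet A) (hA' : MeasurableSet A') {R : ℝ}
    (hR : 0 < R) (hAR : A ⊆ closedBall 0 R) (hAR' : A' ⊆ closedBall 0 R) :
    ∃ w, μ A * μ A' / μ (closedBall 0 (2 * R)) ≤ μ {p | p ∈ A ∧ p + w ∈ A'} := by
  have := FiniteDimensional.proper_real E
  set f : E → ℝ≥0∞ := fun w => μ {p | p ∈ A ∧ p + w ∈ A'} with hf
  have hint : ∫⁻ w in closedBall 0 (2 * R), f w ∂μ = μ A * μ A' := by
    rw [← lintegral_volume_setOf_mem_and_add_mem μ hA hA', ← lintegral_indicator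
      measurableSet_closedBall]
    refine lintegral_congr fun w => ?_
    by_cases hw : w ∈ closedBall (0 : E) (2 * R)
    · simp [hw, hf]
    · rw [indicator_of_notMem hw]
      have : {p | p ∈ A ∧ p + w ∈ A'} = ∅ := by
        refine eq_empty_of_forall_notMem fun p ⟨hp, hpw⟩ => hw ?_
        have h1 := hAR hp
        have h2 := hAR' hpw
        simp only [mem_closedBall, dist_zero_right] at h1 h2 ⊢
        calc ‖w‖ = ‖(p + w) - p‖ := by simp
          _ ≤ ‖p + w‖ + ‖p‖ := norm_sub_le _ _
          _ ≤ 2 * R := by linarith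
      simp [this]
  have hfin : ∀ S ⊆ closedBall (0 : E) R, μ S ≠ ∞ := fun S hS =>
    (measure_mono hS).trans_lt measure_closedBall_lt_top |>.ne
  obtain ⟨w, -, hw⟩ := exists_setLAverage_le (μ := μ) (s := closedBall (0 : E) (2 * R)) (f := f)
    (measure_closedBall_pos _ _ (by linarith)).ne' measurableSet_closedBall.nullMeasurableSet
    (by rw [hint]; exact ENNReal.mul_ne_top (hfin A hAR) (hfin A' hAR'))
  exact ⟨w, by rwa [setLAverage_eq, hint] at hw⟩

theorem volume_hullVolumeIn_le_add {E : Type*} [NormedAddCommGroup E] [NormedSpace ℝ E]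
    [MeasureSpace E] [SigmaFinite (volume : Measure E)] (N : ℕ) (D : Set ℝ≥0∞) (L B : Set E) :
    volume (hullVolumeIn N D L) ≤
      volume (hullVolumeIn N D B) + N * volume L ^ (N - 1) * volume (L \ B) := by
  have hsub : hullVolumeIn N D L ⊆ hullVolumeIn N D B ∪
      ⋃ i, univ.pi (Function.update (fun _ => L) i (L \ B)) := by
    rintro x ⟨hx, hxD⟩
    by_cases hB : ∀ i, x i ∈ B
    · exact Or.inl ⟨hB, hxD⟩
    · push Not at hB
      obtain ⟨i, hi⟩ := hB
      refine Or.inr (mem_iUnion.2 ⟨i, fun j _ => ?_⟩)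
      rcases eq_or_ne j i with rfl | hj
      · simpa using ⟨hx j, hi⟩
      · simpa [hj] using hx j
  refine (measure_mono hsub).trans ((measure_union_le _ _).trans ?_)
  gcongr
  refine (measure_iUnion_fintype_le _ _).trans ?_
  have h : ∀ i : Fin N, volume (univ.pi (Function.update (fun _ => L) i (L \ B))) =
      volume (L \ B) * volume L ^ (N - 1) := by
    intro i
    rw [volume_pi_pi]
    have : (fun j => volume (Function.update (fun _ => L) i (L \ B) j)) =
        Function.update (fun _ => volume L) i (volume (L \ B)) := by
      ext j
      rcases eq_or_ne j i with rfl | hj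
      · simp
      · simp [hj]
    rw [this, Finset.prod_update_of_mem (Finset.mem_univ i)]
    simp [Finset.card_sdiff]
  simp only [h, Finset.sum_const, Finset.card_univ, Fintype.card_fin, nsmul_eq_mul]
  exact le_of_eq (by ring)

/-- Among convex sets of a given volume, the ball maximizes the measure of the configurations
whose convex hull has small volume. -/
theorem volume_hullVolumeIn_le_closedBall {m N : ℕ} {D : Set ℝ≥0∞} (hD : IsLowerSet D)
    {K : Set (EuclideanSpace ℝ (Fin (m + 1)))} (hK : Convex ℝ K) (hKm : MeasurableSet K)
    (hKb : Bornology.IsBounded K) {r : ℝ} (hr : 0 ≤ r) (hvol : volume K = volume (closedBall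
      (0 : EuclideanSpace ℝ (Fin (m + 1))) r)) :
    volume (hullVolumeIn N D K) ≤
      volume (hullVolumeIn N D (closedBall (0 : EuclideanSpace ℝ (Fin (m + 1))) r)) := by
  set B := closedBall (0 : EuclideanSpace ℝ (Fin (m + 1))) r with hB
  obtain ⟨R, hR, hKR, hrR⟩ : ∃ R : ℝ, 0 < R ∧ K ⊆ closedBall 0 R ∧ r ≤ R := by
    obtain ⟨R, hR⟩ := hKb.subset_closedBall 0
    exact ⟨max R (r + 1), lt_max_of_lt_right (by linarith),
      hR.trans (closedBall_subset_closedBall (le_max_left _ _)),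
      le_max_of_le_right (by linarith)⟩
  have hBm : MeasurableSet B := measurableSet_closedBall
  have hBfin : volume B ≠ ∞ := measure_closedBall_lt_top.ne
  set c := volume (closedBall (0 : EuclideanSpace ℝ (Fin (m + 1))) (2 * R))
  have hc : c ≠ ∞ := measure_closedBall_lt_top.ne
  set S : Set ℝ≥0∞ := {d | ∃ L : Set (EuclideanSpace ℝ (Fin (m + 1))), Convex ℝ L ∧
    MeasurableSet L ∧ L ⊆ closedBall 0 R ∧ volume L = volume B ∧
    volume (hullVolumeIn N D K) ≤ volume (hullVolumeIn N D L) ∧ volume (L \ B) = d} with hS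
  have hstep : ∀ d ∈ S, d ≠ 0 → ∃ d' ∈ S, d' + d ^ 2 / c ≤ d := by
    rintro d ⟨L, hL, hLm, hLR, hLv, hLK, rfl⟩ hd
    have hcap : volume (L ∩ B) ≠ ∞ := ((measure_mono inter_subset_right).trans_lt hBfin.lt_top).ne
    have hL1 := measure_inter_add_sdiff (μ := volume) L hBm
    have hsymm : volume (B \ L) = volume (L \ B) := by
      have h2 := measure_inter_add_sdiff (μ := volume) B hLm
      rw [inter_comm, ← hLv, ← hL1] at h2
      exact (ENNReal.add_right_inj hcap).1 h2
    obtain ⟨w, hw⟩ := exists_le_volume_setOf_mem_and_add_mem volume (hLm.diff hBm)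
      (hBm.diff hLm) hR (sdiff_subset.trans hLR)
      (sdiff_subset.trans (closedBall_subset_closedBall hrR))
    rw [hsymm, ← sq] at hw
    have hw0 : w ≠ 0 := by
      rintro rfl
      have hempty : {p | p ∈ L \ B ∧ p + 0 ∈ B \ L} = ∅ :=
        eq_empty_of_forall_notMem fun p hp => hp.1.2 (by simpa using hp.2.1)
      rw [hempty, measure_empty, nonpos_iff_eq_zero, ENNReal.div_eq_zero_iff] at hw
      exact hw.elim (pow_ne_zero 2 hd) hc
    obtain ⟨L', hL', hLm', hLR', hLv', hLK', hgain⟩ :=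
      exists_symmetral (N := N) hD hL hLm hR.le hr hLR hw0
    refine ⟨_, ⟨L', hL', hLm', hLR', hLv'.trans hLv, hLK.trans hLK', rfl⟩, ?_⟩
    have hL1' := measure_inter_add_sdiff (μ := volume) L' hBm
    rw [hLv', ← hL1] at hL1'
    refine (ENNReal.add_le_add_iff_left hcap).1 ?_
    calc volume (L ∩ B) + (volume (L' \ B) + volume (L \ B) ^ 2 / c)
        = (volume (L ∩ B) + volume (L \ B) ^ 2 / c) + volume (L' \ B) := by ring
      _ ≤ volume (L' ∩ B) + volume (L' \ B) := by
        gcongr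
        exact (add_le_add_right hw _).trans hgain
      _ = _ := hL1'
  have hKS : volume (K \ B) ∈ S := ⟨K, hK, hKm, hKR, hvol, le_rfl, rfl⟩
  have hinf : sInf S = 0 := by
    by_contra hne
    have hfin : sInf S ≠ ∞ := by
      refine ((sInf_le hKS).trans_lt ?_).ne
      exact (measure_mono sdiff_subset).trans_lt (hvol ▸ hBfin.lt_top)
    have hpos : sInf S ^ 2 / c ≠ 0 := (ENNReal.div_pos (pow_ne_zero 2 hne) hc).ne'
    obtain ⟨d, hd, hlt⟩ := exists_lt_of_csInf_lt ⟨_, hKS⟩ (ENNReal.lt_add_right hfin hpos)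
    obtain ⟨d', hd', hle⟩ := hstep d hd fun h0 => hne (le_antisymm (h0 ▸ sInf_le hd) zero_le)
    refine absurd hlt (not_lt.2 (le_trans ?_ hle))
    gcongr
    · exact sInf_le hd'
    · exact sInf_le hd
  set C := (N : ℝ≥0∞) * volume B ^ (N - 1)
  have hC : C ≠ ∞ := ENNReal.mul_ne_top (by simp) (ENNReal.pow_ne_top hBfin)
  have hle : (volume (hullVolumeIn N D K) - volume (hullVolumeIn N D B)) / C ≤ sInf S := by
    refine le_sInf ?_
    rintro d ⟨L, hL, hLm, hLR, hLv, hLK, rfl⟩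
    refine ENNReal.div_le_of_le_mul' (tsub_le_iff_left.2 (hLK.trans ?_))
    have := volume_hullVolumeIn_le_add N D L B
    rwa [hLv] at this
  rw [hinf, nonpos_iff_eq_zero, ENNReal.div_eq_zero_iff] at hle
  exact tsub_eq_zero_iff_le.1 (hle.resolve_right hC)

/-! ### Normalization and comparison of expectations -/

open scoped Pointwise
theorem hullVolumeIn_smul {E : Type*} [NormedAddCommGroup E] [NormedSpace ℝ E]
    [FiniteDimensional ℝ E] [MeasureSpace E] [BorelSpace E]
    [(volume : Measure E).IsAddHaarMeasure] (N : ℕ) (D : Set ℝ≥0∞) (L : Set E) {c : ℝ}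
    (hc : 0 < c) :
    hullVolumeIn N D (c • L) =
      c • hullVolumeIn N {s | ENNReal.ofReal (c ^ Module.finrank ℝ E) * s ∈ D} L := by
  ext x
  obtain ⟨y, rfl⟩ : ∃ y, x = c • y := ⟨c⁻¹ • x, (smul_inv_smul₀ hc.ne' x).symm⟩
  rw [smul_mem_smul_set_iff₀ hc.ne']
  have h : range (c • y) = c • range y := by
    ext; simp [mem_smul_set]
  simp only [hullVolumeIn, mem_ofPred_eq, h, convexHull_smul, Measure.addHaar_smul,
    abs_of_pos (pow_pos hc _), Pi.smul_apply, smul_mem_smul_set_iff₀ hc.ne']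

theorem jointUnif_eq (n N : ℕ) {K : Set (EuclideanSpace ℝ (Fin n))} (hK : volume K ≠ 0) :
    jointUnif n N K = ((volume K)⁻¹ ^ N) • volume.restrict (univ.pi fun _ => K) := by
  have : SigmaFinite (unifMeasure n K) := by
    have h : (volume K)⁻¹ ≠ ∞ := ENNReal.inv_ne_top.2 hK
    rw [unifMeasure, ← ENNReal.coe_toNNReal h]
    exact inferInstanceAs (SigmaFinite ((volume K)⁻¹.toNNReal • volume.restrict K))
  refine Measure.pi_eq fun s hs => ?_
  rw [Measure.smul_apply, Measure.restrict_apply (MeasurableSet.univ_pi hs), ← pi_inter_distrib,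
    volume_pi_pi]
  simp [unifMeasure, Measure.restrict_apply (hs _), Finset.prod_mul_distrib]

theorem isProbabilityMeasure_jointUnif (n N : ℕ) {K : Set (EuclideanSpace ℝ (Fin n))}
    (hK : volume K ≠ 0) (hK' : volume K ≠ ∞) : IsProbabilityMeasure (jointUnif n N K) := by
  refine ⟨?_⟩
  rw [jointUnif_eq n N hK]
  simp [volume_pi_pi, ← mul_pow, ENNReal.inv_mul_cancel hK hK']

theorem measurable_randPolyVol (n N : ℕ) (K : Set (EuclideanSpace ℝ (Fin n))) :
    Measurable (randPolyVol n N K) :=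
  (measurable_measure_convexHull_range volume).ennreal_toReal.div_const _

theorem volume_convexHull_range_ne_top {n N : ℕ} (x : Fin N → EuclideanSpace ℝ (Fin n)) :
    volume (convexHull ℝ (range x)) ≠ ∞ :=
  (isBounded_convexHull.2 (finite_range x).isBounded).measure_lt_top.ne

/-- The normalized volume of a random polytope in a convex body stochastically dominates that of
a random polytope in the ball. -/
theorem jointUnif_randPolyVol_mem_le_closedBall {m N : ℕ}
    {K : Set (EuclideanSpace ℝ (Fin (m + 1)))} (hK : Convex ℝ K) (hKc : IsCompact K)
    (hK0 : volume K ≠ 0) {T : Set ℝ} (hT : IsLowerSet T) :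
    jointUnif (m + 1) N K {x | randPolyVol (m + 1) N K x ∈ T} ≤
      jointUnif (m + 1) N (closedBall 0 1) {x | randPolyVol (m + 1) N (closedBall 0 1) x ∈ T} := by
  set B := closedBall (0 : EuclideanSpace ℝ (Fin (m + 1))) 1 with hB
  have hB0 : volume B ≠ 0 := (measure_closedBall_pos _ _ one_pos).ne'
  have hB1 : volume B ≠ ∞ := measure_closedBall_lt_top.ne
  have hK1 : volume K ≠ ∞ := hKc.measure_ne_top
  have hfin : Module.finrank ℝ (EuclideanSpace ℝ (Fin (m + 1))) = m + 1 := by simp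
  obtain ⟨r, hr, hrv⟩ : ∃ r : ℝ, 0 < r ∧ volume K = ENNReal.ofReal (r ^ (m + 1)) * volume B := by
    have hpos : 0 < (volume K / volume B).toReal :=
      ENNReal.toReal_pos (ENNReal.div_pos hK0 hB1).ne' (ENNReal.div_ne_top hK1 hB0)
    refine ⟨(volume K / volume B).toReal ^ ((m + 1 : ℕ) : ℝ)⁻¹, by positivity, ?_⟩
    rw [Real.rpow_inv_natCast_pow hpos.le (Nat.succ_ne_zero m),
      ENNReal.ofReal_toReal (ENNReal.div_ne_top hK1 hB0), ENNReal.div_mul_cancel hB0 hB1]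
  set q := ENNReal.ofReal (r ^ (m + 1)) with hq
  have hq0 : q ≠ 0 := by simp [hq]; positivity
  have hq1 : q ≠ ∞ := ENNReal.ofReal_ne_top
  have hball : closedBall (0 : EuclideanSpace ℝ (Fin (m + 1))) r = r • B := by
    rw [hB, _root_.smul_closedBall _ _ zero_le_one, smul_zero, mul_one, Real.norm_of_nonneg hr.le]
  set D : Set ℝ≥0∞ := {s | s ≠ ∞ ∧ s.toReal / (volume K).toReal ∈ T} with hDdef
  have hD : IsLowerSet D := by
    rintro a b hba ⟨ha, haT⟩
    refine ⟨ne_top_of_le_ne_top ha hba, hT ?_ haT⟩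
    have := ENNReal.toReal_mono ha hba
    gcongr
  have hvol : volume K = volume (closedBall (0 : EuclideanSpace ℝ (Fin (m + 1))) r) := by
    rw [hball, Measure.addHaar_smul, hfin, abs_of_pos (pow_pos hr _), hrv]
  have hmain := volume_hullVolumeIn_le_closedBall (N := N) hD hK hKc.measurableSet hKc.isBounded
    hr.le hvol
  rw [hball, hullVolumeIn_smul N D B hr, Measure.addHaar_smul, hfin, ← hq,
    Module.finrank_pi_fintype] at hmain
  simp only [hfin, Finset.sum_const, Finset.card_univ, Fintype.card_fin, smul_eq_mul] at hmain
  rw [abs_of_pos (pow_pos hr _), mul_comm N, pow_mul, ENNReal.ofReal_pow (by positivity),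
    ← hq] at hmain
  have hmeas : ∀ L, MeasurableSet {x | randPolyVol (m + 1) N L x ∈ T} := fun L =>
    hT.ordConnected.measurableSet.preimage (measurable_randPolyVol _ _ L)
  rw [jointUnif_eq _ _ hK0, jointUnif_eq _ _ hB0, Measure.smul_apply, Measure.smul_apply,
    Measure.restrict_apply (hmeas _), Measure.restrict_apply (hmeas _), smul_eq_mul, smul_eq_mul]
  have hL : {x | randPolyVol (m + 1) N K x ∈ T} ∩ (univ.pi fun _ => K) = hullVolumeIn N D K := by
    ext x
    simp [hullVolumeIn, randPolyVol, hDdef, volume_convexHull_range_ne_top, and_comm]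
  have hR : {x | randPolyVol (m + 1) N B x ∈ T} ∩ (univ.pi fun _ => B) =
      hullVolumeIn N {s | q * s ∈ D} B := by
    have hq2 : q.toReal ≠ 0 := (ENNReal.toReal_pos hq0 hq1).ne'
    ext x
    simp [hullVolumeIn, randPolyVol, hDdef, volume_convexHull_range_ne_top, and_comm, hrv,
      ENNReal.mul_ne_top hq1, mul_div_mul_left _ _ hq2]
  rw [hL, hR]
  calc (volume K)⁻¹ ^ N * volume (hullVolumeIn N D K)
      ≤ (volume K)⁻¹ ^ N * (q ^ N * volume (hullVolumeIn N {s | q * s ∈ D} B)) := by gcongr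
    _ = ((volume K)⁻¹ * q) ^ N * volume (hullVolumeIn N {s | q * s ∈ D} B) := by
      rw [mul_pow, mul_assoc]
    _ = _ := by
      rw [hrv, ENNReal.mul_inv (Or.inl hq0) (Or.inl hq1), mul_right_comm,
        ENNReal.inv_mul_cancel hq0 hq1, one_mul]

theorem randPolyVol_nonneg {n N : ℕ} {K : Set (EuclideanSpace ℝ (Fin n))}
    (x : Fin N → EuclideanSpace ℝ (Fin n)) : 0 ≤ randPolyVol n N K x := by
  unfold randPolyVol; positivity

theorem ae_randPolyVol_le_one (n N : ℕ) {K : Set (EuclideanSpace ℝ (Fin n))} (hK : Convex ℝ K)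
    (hKm : MeasurableSet K) (hK0 : volume K ≠ 0) (hK1 : volume K ≠ ∞) :
    ∀ᵐ x ∂jointUnif n N K, randPolyVol n N K x ≤ 1 := by
  rw [jointUnif_eq n N hK0]
  refine Measure.ae_smul_measure ?_ _
  filter_upwards [ae_restrict_mem (MeasurableSet.univ_pi fun _ => hKm)] with x hx
  refine div_le_one_of_le₀ (ENNReal.toReal_mono hK1 (measure_mono ?_)) ENNReal.toReal_nonneg
  exact convexHull_min (range_subset_iff.2 fun i => hx i (mem_univ i)) hK

theorem lintegral_le_of_forall_measure_le {Ω Ω' : Type*} [MeasurableSpace Ω] [MeasurableSpace Ω']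
    {μ : Measure Ω} {ν : Measure Ω'} [IsProbabilityMeasure μ] [IsProbabilityMeasure ν]
    {X : Ω → ℝ} {Y : Ω' → ℝ} (hX : Measurable X) (hY : Measurable Y) (hX0 : ∀ ω, 0 ≤ X ω)
    (hY0 : ∀ ω, 0 ≤ Y ω) (h : ∀ t, ν {ω | Y ω ≤ t} ≤ μ {ω | X ω ≤ t}) :
    ∫⁻ ω, ENNReal.ofReal (X ω) ∂μ ≤ ∫⁻ ω, ENNReal.ofReal (Y ω) ∂ν := by
  rw [lintegral_eq_lintegral_meas_lt μ (.of_forall hX0) hX.aemeasurable,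
    lintegral_eq_lintegral_meas_lt ν (.of_forall hY0) hY.aemeasurable]
  refine lintegral_mono fun t => ?_
  have hXt : {ω | t < X ω} = {ω | X ω ≤ t}ᶜ := by ext; simp
  have hYt : {ω | t < Y ω} = {ω | Y ω ≤ t}ᶜ := by ext; simp
  rw [hXt, hYt, prob_compl_eq_one_sub (measurableSet_le hX measurable_const),
    prob_compl_eq_one_sub (measurableSet_le hY measurable_const)]
  exact tsub_le_tsub_left (h t) 1

/-- Among all convex bodies `K` in `ℝⁿ`, the expectation `𝔼 f(U_{K,N})` of any strictly
increasing continuous `f : ℝ₊ → ℝ₊` applied to the normalized volume of a random polytope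
on `N ≥ n+1` independent uniform points is minimized when `K` is the Euclidean ball. -/
theorem expectation_f_randPolyVol_ge_ball
    (n N : ℕ) (hn : 0 < n) (hN : n + 1 ≤ N)
    (K : Set (EuclideanSpace ℝ (Fin n)))
    (hK_conv : Convex ℝ K) (hK_comp : IsCompact K)
    (hK_int : (interior K).Nonempty)
    (f : ℝ → ℝ)
    (hf_mono : StrictMonoOn f (Set.Ici 0))
    (hf_cont : ContinuousOn f (Set.Ici 0))
    (hf_nonneg : ∀ t, 0 ≤ t → 0 ≤ f t) :
    ∫ x, f (randPolyVol n N K x) ∂(jointUnif n N K) ≥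
      ∫ x, f (randPolyVol n N (Metric.closedBall (0 : EuclideanSpace ℝ (Fin n)) 1) x)
        ∂(jointUnif n N (Metric.closedBall (0 : EuclideanSpace ℝ (Fin n)) 1)) := by

  obtain ⟨m, rfl⟩ : ∃ m, n = m + 1 := ⟨n - 1, by omega⟩
  set B := closedBall (0 : EuclideanSpace ℝ (Fin (m + 1))) 1
  have hB0 : volume B ≠ 0 := (measure_closedBall_pos _ _ one_pos).ne'
  have hB1 : volume B ≠ ∞ := measure_closedBall_lt_top.ne
  have hK1 : volume K ≠ ∞ := hK_comp.measure_ne_top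
  have hK0 : volume K ≠ 0 := (Measure.measure_pos_of_nonempty_interior volume hK_int).ne'
  have := isProbabilityMeasure_jointUnif (m + 1) N hK0 hK1
  have := isProbabilityMeasure_jointUnif (m + 1) N hB0 hB1
  set g : ℝ → ℝ := fun u => f (max u 0) with hg
  have hg_mono : Monotone g := fun a b hab =>
    hf_mono.monotoneOn (mem_Ici.2 (le_max_right _ _)) (mem_Ici.2 (le_max_right _ _)) (max_le_max_right 0 hab)
  have hg_nonneg : ∀ u, 0 ≤ g u := fun u => hf_nonneg _ (le_max_right _ _)
  have hfg : ∀ L x, f (randPolyVol (m + 1) N L x) = g (randPolyVol (m + 1) N L x) := by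
    intro L x
    rw [hg]
    simp only [max_eq_left (randPolyVol_nonneg x)]
  have hmeas : ∀ L, Measurable fun x => g (randPolyVol (m + 1) N L x) := fun L =>
    hg_mono.measurable.comp (measurable_randPolyVol _ _ L)
  simp only [hfg, ge_iff_le]
  rw [integral_eq_lintegral_of_nonneg_ae (.of_forall fun _ => hg_nonneg _)
      (hmeas K).aestronglyMeasurable,
    integral_eq_lintegral_of_nonneg_ae (.of_forall fun _ => hg_nonneg _)
      (hmeas B).aestronglyMeasurable]
  refine ENNReal.toReal_mono ?_ ?_
  · refine ne_top_of_le_ne_top (ENNReal.ofReal_ne_top (r := g 1)) ?_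
    refine (lintegral_mono_ae (g := fun _ => ENNReal.ofReal (g 1)) ?_).trans (by simp)
    filter_upwards [ae_randPolyVol_le_one (m + 1) N hK_conv hK_comp.measurableSet hK0 hK1]
      with x hx
    exact ENNReal.ofReal_le_ofReal (hg_mono hx)
  · exact lintegral_le_of_forall_measure_le (hmeas B) (hmeas K) (fun _ => hg_nonneg _)
      (fun _ => hg_nonneg _) fun t => jointUnif_randPolyVol_mem_le_closedBall
        (T := {u | g u ≤ t}) hK_conv hK_comp hK0 fun a b hab ha => (hg_mono hab).trans ha
end

section
/- Let K be a symmetric convex body in ℝⁿ and let 1 ≤ p < ∞. Then ‖U_K‖_p ≤ ((n+1)/2ⁿ) ‖V_K‖_p and ‖V_K‖_p ≤ 2ⁿ ‖U_K‖_p; equivalently, (2/(n+1)^{1/n}) ‖U_K‖_p^{1/n} ≤ ‖V_K‖_p^{1/n} ≤ 2 ‖U_K‖_p^{1/n}. -/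
open MeasureTheory Pointwise

/-- `U_K`: the normalized volume of the convex hull of `n+1` points. -/
noncomputable def randSimplexVol (n : ℕ) (K : Set (EuclideanSpace ℝ (Fin n)))
    (x : Fin (n + 1) → EuclideanSpace ℝ (Fin n)) : ℝ :=
  (volume (convexHull ℝ (Set.range x))).toReal / (volume K).toReal

/-- `V_K`: the normalized volume of the symmetric convex hull of `n` points. -/
noncomputable def randCrossVol (n : ℕ) (K : Set (EuclideanSpace ℝ (Fin n)))
    (x : Fin n → EuclideanSpace ℝ (Fin n)) : ℝ :=
  (volume (convexHull ℝ (Set.range x ∪ -Set.range x))).toReal / (volume K).toReal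

/-- `‖U_K‖_p`, the `p`-th moment norm of the normalized volume of a random simplex in `K`. -/
noncomputable def lpNormU (n : ℕ) (K : Set (EuclideanSpace ℝ (Fin n))) (p : ℝ) : ℝ :=
  (∫ x, |randSimplexVol n K x| ^ p ∂(jointUnif n (n + 1) K)) ^ (1 / p)

/-- `‖V_K‖_p`, the `p`-th moment norm of the normalized volume of a random
crosspolytope in `K`. -/
noncomputable def lpNormV (n : ℕ) (K : Set (EuclideanSpace ℝ (Fin n))) (p : ℝ) : ℝ :=
  (∫ x, |randCrossVol n K x| ^ p ∂(jointUnif n n K)) ^ (1 / p)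

/-- The convex hull of the origin and the standard basis vectors of `ℝⁿ`. -/
def cornerSimplex (n : ℕ) : Set (EuclideanSpace ℝ (Fin n)) :=
  convexHull ℝ (insert 0 (Set.range (EuclideanSpace.basisFun (Fin n) ℝ)))

/-- The determinant of `n` vectors in `ℝⁿ`. -/
noncomputable def rowDet {n : ℕ} (x : Fin n → EuclideanSpace ℝ (Fin n)) : ℝ :=
  (Matrix.of fun i j => x i j).det

/-- The matrix with rows `(1, x i)`. -/
def augMatrix {n : ℕ} (x : Fin (n + 1) → EuclideanSpace ℝ (Fin n)) :
    Matrix (Fin (n + 1)) (Fin (n + 1)) ℝ :=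
  Matrix.of fun i => Fin.cons 1 (x i)

section Determinants

variable {n : ℕ}

lemma det_eq_rowDet (f : Fin n → EuclideanSpace ℝ (Fin n)) (A : Matrix (Fin n) (Fin n) ℝ)
    (h : ∀ i j, A i j = f i j) : A.det = rowDet f := by
  unfold rowDet
  congr 1
  ext i j
  exact h i j

lemma det_augMatrix (x : Fin (n + 1) → EuclideanSpace ℝ (Fin n)) :
    (augMatrix x).det = ∑ i : Fin (n + 1), (-1) ^ (i : ℕ) * rowDet fun k => x (i.succAbove k) := by
  rw [Matrix.det_succ_column_zero]
  refine Finset.sum_congr rfl fun i _ => ?_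
  rw [det_eq_rowDet (fun k => x (i.succAbove k)) _ (by simp [augMatrix])]
  simp [augMatrix]

lemma det_augMatrix_eq_rowDet_sub (x : Fin (n + 1) → EuclideanSpace ℝ (Fin n)) :
    (augMatrix x).det = rowDet fun i => x i.succ - x 0 := by
  let B : Matrix (Fin (n + 1)) (Fin (n + 1)) ℝ :=
    Matrix.of (Fin.cons (Fin.cons 1 (x 0)) fun i => Fin.cons 0 (x i.succ - x 0))
  have h : (augMatrix x).det = B.det := by
    refine Matrix.det_eq_of_forall_row_eq_smul_add_const (Fin.cons 0 fun _ => 1) 0 (by simp) ?_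
    intro i j
    refine Fin.cases ?_ (fun i => ?_) i <;> refine Fin.cases ?_ (fun j => ?_) j <;>
      simp [augMatrix, B]
  rw [h, Matrix.det_succ_column_zero, Fin.sum_univ_succ,
    det_eq_rowDet (fun i => x i.succ - x 0) _ (by simp [B])]
  simp [B]

/-- Averaging over the reflection of the first vertex through the origin. -/
lemma det_augMatrix_add_reflect (x : Fin (n + 1) → EuclideanSpace ℝ (Fin n)) :
    (augMatrix x).det + (augMatrix (Function.update x 0 (-x 0))).det =
      2 * rowDet fun i => x i.succ := by
  have h1 : augMatrix x = (augMatrix x).updateRow 0 (Fin.cons 1 (x 0)) := by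
    ext i j
    by_cases hi : i = 0
    · subst hi; simp [augMatrix]
    · simp [augMatrix, hi]
  have h2 : augMatrix (Function.update x 0 (-x 0)) =
      (augMatrix x).updateRow 0 (Fin.cons 1 (-(x 0).ofLp)) := by
    ext i j
    by_cases hi : i = 0
    · subst hi; simp [augMatrix]
    · simp [augMatrix, hi]
  have h3 : (Fin.cons 1 (x 0) + Fin.cons 1 (-(x 0).ofLp) : Fin (n + 1) → ℝ) = Fin.cons 2 0 := by
    ext j
    refine Fin.cases ?_ (fun j => ?_) j
    · simp; norm_num
    · simp
  rw [h2]
  nth_rw 1 [h1]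
  rw [← Matrix.det_updateRow_add, h3, Matrix.det_succ_row_zero, Fin.sum_univ_succ,
    det_eq_rowDet (fun i => x i.succ) _ (by simp [augMatrix])]
  simp

lemma continuous_rowDet : Continuous (rowDet (n := n)) := by
  unfold rowDet
  refine Continuous.matrix_det ?_
  refine continuous_pi fun i => continuous_pi fun j => ?_
  simp only [Matrix.of_apply]
  fun_prop

lemma continuous_det_augMatrix :
    Continuous fun x : Fin (n + 1) → EuclideanSpace ℝ (Fin n) => (augMatrix x).det := by
  simp_rw [det_augMatrix_eq_rowDet_sub]
  exact continuous_rowDet.comp (by fun_prop)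

end Determinants

section Volumes

variable {n : ℕ}

lemma image_constr_cornerSimplex (y : Fin n → EuclideanSpace ℝ (Fin n)) :
    (EuclideanSpace.basisFun (Fin n) ℝ).toBasis.constr ℝ y '' cornerSimplex n =
      convexHull ℝ (insert 0 (Set.range y)) := by
  rw [cornerSimplex, LinearMap.image_convexHull, Set.image_insert_eq, map_zero, ← Set.range_comp]
  congr 3
  ext1 i
  have := (EuclideanSpace.basisFun (Fin n) ℝ).toBasis.constr_basis ℝ y i
  simpa only [OrthonormalBasis.coe_toBasis, Function.comp_apply] using this

lemma det_constr_basisFun (y : Fin n → EuclideanSpace ℝ (Fin n)) :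
    LinearMap.det ((EuclideanSpace.basisFun (Fin n) ℝ).toBasis.constr ℝ y) = rowDet y := by
  rw [← LinearMap.det_toMatrix (EuclideanSpace.basisFun (Fin n) ℝ).toBasis, rowDet,
    ← Matrix.det_transpose]
  congr 1
  ext i j
  rw [Matrix.transpose_apply, LinearMap.toMatrix_apply, Module.Basis.constr_basis]
  simp

lemma volume_convexHull_insert_zero (y : Fin n → EuclideanSpace ℝ (Fin n)) :
    volume (convexHull ℝ (insert 0 (Set.range y))) =
      ENNReal.ofReal |rowDet y| * volume (cornerSimplex n) := by
  rw [← image_constr_cornerSimplex, Measure.addHaar_image_linearMap, det_constr_basisFun]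

lemma volume_convexHull_range (x : Fin (n + 1) → EuclideanSpace ℝ (Fin n)) :
    volume (convexHull ℝ (Set.range x)) =
      ENNReal.ofReal |(augMatrix x).det| * volume (cornerSimplex n) := by
  have h : Set.range x = x 0 +ᵥ insert 0 (Set.range fun i : Fin n => x i.succ - x 0) := by
    rw [← Set.image_vadd, Set.image_insert_eq, ← Set.range_comp, Fin.range_fin_succ]
    simp [Function.comp_def, Fin.tail_def]
  rw [h, convexHull_vadd, measure_vadd, volume_convexHull_insert_zero,
    det_augMatrix_eq_rowDet_sub]

/-- The convex hull of the origin and the vectors `s i • eᵢ` for a choice of signs `s`. -/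
def signedSimplex (s : Fin n → ℤˣ) : Set (EuclideanSpace ℝ (Fin n)) :=
  convexHull ℝ (insert 0
    (Set.range fun i => ((s i : ℤ) : ℝ) • EuclideanSpace.basisFun (Fin n) ℝ i))

lemma volume_signedSimplex (s : Fin n → ℤˣ) :
    volume (signedSimplex s) = volume (cornerSimplex n) := by
  have hdet : |rowDet fun i => ((s i : ℤ) : ℝ) • EuclideanSpace.basisFun (Fin n) ℝ i| = 1 := by
    have h : (Matrix.of fun i j =>
        (((s i : ℤ) : ℝ) • EuclideanSpace.basisFun (Fin n) ℝ i) j) =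
        Matrix.diagonal fun i => ((s i : ℤ) : ℝ) := by
      ext i j
      simp [Matrix.diagonal_apply, eq_comm]
    rw [rowDet, h, Matrix.det_diagonal, Finset.abs_prod]
    refine Finset.prod_eq_one fun i _ => ?_
    rcases Int.units_eq_one_or (s i) with hi | hi <;> simp [hi]
  rw [signedSimplex, volume_convexHull_insert_zero, hdet]
  simp

lemma nonneg_of_mem_signedSimplex {s : Fin n → ℤˣ} {x : EuclideanSpace ℝ (Fin n)}
    (hx : x ∈ signedSimplex s) (i : Fin n) : 0 ≤ ((s i : ℤ) : ℝ) * x i := by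
  have hconv : Convex ℝ {x : EuclideanSpace ℝ (Fin n) | 0 ≤ ((s i : ℤ) : ℝ) * x i} := by
    intro u hu v hv a b ha hb _
    simp only [Set.mem_ofPred_eq, PiLp.add_apply, PiLp.smul_apply, smul_eq_mul] at *
    nlinarith [mul_nonneg ha hu, mul_nonneg hb hv]
  refine convexHull_min ?_ hconv hx
  rintro _ (rfl | ⟨j, rfl⟩)
  · simp
  · by_cases hij : i = j
    · subst hij
      simp [mul_self_nonneg]
    · simp [hij]

lemma aedisjoint_signedSimplex {s t : Fin n → ℤˣ} (hst : s ≠ t) :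
    AEDisjoint volume (signedSimplex s) (signedSimplex t) := by
  obtain ⟨i, hi⟩ := Function.ne_iff.1 hst
  let L : Submodule ℝ (EuclideanSpace ℝ (Fin n)) :=
    LinearMap.ker (EuclideanSpace.proj i : EuclideanSpace ℝ (Fin n) →L[ℝ] ℝ).toLinearMap
  have hL : L ≠ ⊤ := by
    intro h
    have : EuclideanSpace.single i (1 : ℝ) ∈ L := h ▸ Submodule.mem_top
    simp [L] at this
  refine measure_mono_null ?_ (Measure.addHaar_submodule volume L hL)
  rintro x ⟨hs, ht⟩
  have h1 := nonneg_of_mem_signedSimplex hs i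
  have h2 := nonneg_of_mem_signedSimplex ht i
  have hx : x i = 0 := by
    rcases Int.units_eq_one_or (s i) with a | a <;> rcases Int.units_eq_one_or (t i) with b | b
    · exact absurd (a.trans b.symm) hi
    · simp only [a, b, Units.val_one, Units.val_neg, Int.cast_neg, Int.cast_one] at h1 h2
      linarith
    · simp only [a, b, Units.val_one, Units.val_neg, Int.cast_neg, Int.cast_one] at h1 h2
      linarith
    · exact absurd (a.trans b.symm) hi
  simpa [L] using hx

lemma isCompact_signedSimplex (s : Fin n → ℤˣ) : IsCompact (signedSimplex s) :=
  ((Set.finite_range _).insert 0).isCompact_convexHull ℝ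

lemma mem_iUnion_signedSimplex {x : EuclideanSpace ℝ (Fin n)} (hx : ∑ i, |x i| ≤ 1) :
    x ∈ ⋃ s : Fin n → ℤˣ, signedSimplex s := by
  let s : Fin n → ℤˣ := fun i => if 0 ≤ x i then 1 else -1
  refine Set.mem_iUnion.2 ⟨s, ?_⟩
  have hs : ∀ i, |x i| * ((s i : ℤ) : ℝ) = x i := by
    intro i
    by_cases h : 0 ≤ x i
    · simp [s, h, abs_of_nonneg]
    · simp [s, h, abs_of_neg (not_le.1 h)]
  let z : Option (Fin n) → EuclideanSpace ℝ (Fin n) := fun o =>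
    o.elim 0 fun i => ((s i : ℤ) : ℝ) • EuclideanSpace.basisFun (Fin n) ℝ i
  let w : Option (Fin n) → ℝ := fun o => o.elim (1 - ∑ i, |x i|) fun i => |x i|
  have key : ∑ o, w o • z o ∈ signedSimplex s := by
    have hconv : Convex ℝ (signedSimplex s) := convex_convexHull ℝ _
    refine hconv.sum_mem ?_ ?_ ?_
    · rintro (_ | i) _
      · simpa [w] using hx
      · simp [w]
    · simp [w, Fintype.sum_option]
    · rintro (_ | i) _
      · exact subset_convexHull ℝ _ (Set.mem_insert _ _)
      · exact subset_convexHull ℝ _ (Set.mem_insert_of_mem _ ⟨i, rfl⟩)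
  convert key
  ext j
  simp [w, z, Fintype.sum_option, Finset.sum_apply, hs, smul_smul, Pi.single_apply]

lemma convexHull_basis_union_neg (hn : 0 < n) :
    convexHull ℝ (Set.range (EuclideanSpace.basisFun (Fin n) ℝ) ∪
      -Set.range (EuclideanSpace.basisFun (Fin n) ℝ)) =
      ⋃ s : Fin n → ℤˣ, signedSimplex s := by
  apply Set.Subset.antisymm
  · intro x hx
    refine mem_iUnion_signedSimplex ?_
    have hconv : Convex ℝ {x : EuclideanSpace ℝ (Fin n) | ∑ i, |x i| ≤ 1} := by
      intro u hu v hv a b ha hb hab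
      simp only [Set.mem_ofPred_eq, PiLp.add_apply, PiLp.smul_apply, smul_eq_mul] at *
      calc ∑ i, |a * u i + b * v i| ≤ ∑ i, (a * |u i| + b * |v i|) := by
            refine Finset.sum_le_sum fun i _ => (abs_add_le _ _).trans ?_
            rw [abs_mul, abs_mul, abs_of_nonneg ha, abs_of_nonneg hb]
        _ = a * ∑ i, |u i| + b * ∑ i, |v i| := by
            rw [Finset.sum_add_distrib, Finset.mul_sum, Finset.mul_sum]
        _ ≤ 1 := by nlinarith
    refine convexHull_min ?_ hconv hx
    rintro y (⟨j, rfl⟩ | ⟨j, hj⟩)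
    · simp [apply_ite abs]
    · have : y = -EuclideanSpace.basisFun (Fin n) ℝ j := by rw [hj, neg_neg]
      subst this
      simp [apply_ite abs]
  · refine Set.iUnion_subset fun s => convexHull_min ?_ (convex_convexHull ℝ _)
    have hpos : ∀ i, EuclideanSpace.basisFun (Fin n) ℝ i ∈
        convexHull ℝ (Set.range (EuclideanSpace.basisFun (Fin n) ℝ) ∪
          -Set.range (EuclideanSpace.basisFun (Fin n) ℝ)) := fun i =>
      subset_convexHull ℝ _ (Or.inl ⟨i, rfl⟩)
    have hneg : ∀ i, -EuclideanSpace.basisFun (Fin n) ℝ i ∈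
        convexHull ℝ (Set.range (EuclideanSpace.basisFun (Fin n) ℝ) ∪
          -Set.range (EuclideanSpace.basisFun (Fin n) ℝ)) := fun i =>
      subset_convexHull ℝ _ (Or.inr ⟨i, by simp⟩)
    rintro _ (rfl | ⟨i, rfl⟩)
    · have h := convex_convexHull ℝ _ (hpos ⟨0, hn⟩) (hneg ⟨0, hn⟩)
        (by norm_num : (0 : ℝ) ≤ 1 / 2) (by norm_num : (0 : ℝ) ≤ 1 / 2) (by norm_num)
      rwa [smul_neg, add_neg_cancel] at h
    · rcases Int.units_eq_one_or (s i) with h | h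
      · simpa [h] using hpos i
      · simpa [h] using hneg i

lemma volume_convexHull_basis_union_neg (hn : 0 < n) :
    volume (convexHull ℝ (Set.range (EuclideanSpace.basisFun (Fin n) ℝ) ∪
      -Set.range (EuclideanSpace.basisFun (Fin n) ℝ))) = 2 ^ n * volume (cornerSimplex n) := by
  rw [convexHull_basis_union_neg hn, measure_iUnion₀ (fun s t h => aedisjoint_signedSimplex h)
    (fun s => (isCompact_signedSimplex s).measurableSet.nullMeasurableSet)]
  simp [volume_signedSimplex, tsum_fintype]

lemma volume_convexHull_range_union_neg (hn : 0 < n) (x : Fin n → EuclideanSpace ℝ (Fin n)) :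
    volume (convexHull ℝ (Set.range x ∪ -Set.range x)) =
      ENNReal.ofReal |rowDet x| * (2 ^ n * volume (cornerSimplex n)) := by
  have himg : (EuclideanSpace.basisFun (Fin n) ℝ).toBasis.constr ℝ x ''
      Set.range (EuclideanSpace.basisFun (Fin n) ℝ) = Set.range x := by
    rw [← Set.range_comp]
    congr 1
    ext1 i
    have := (EuclideanSpace.basisFun (Fin n) ℝ).toBasis.constr_basis ℝ x i
    simpa only [OrthonormalBasis.coe_toBasis, Function.comp_apply] using this
  rw [← volume_convexHull_basis_union_neg hn, ← det_constr_basisFun,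
    ← Measure.addHaar_image_linearMap, LinearMap.image_convexHull, Set.image_union, Set.image_neg,
    himg]

end Volumes

section Moments

variable {n : ℕ} {K : Set (EuclideanSpace ℝ (Fin n))}

lemma isProbabilityMeasure_unifMeasure (h0 : volume K ≠ 0) (htop : volume K ≠ ⊤) :
    IsProbabilityMeasure (unifMeasure n K) :=
  ⟨by simp [unifMeasure, ENNReal.inv_mul_cancel h0 htop]⟩

lemma measurePreserving_neg_unifMeasure (hK : MeasurableSet K) (hsymm : K = -K) :
    MeasurePreserving Neg.neg (unifMeasure n K) (unifMeasure n K) := by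
  have h := (Measure.measurePreserving_neg
    (volume : Measure (EuclideanSpace ℝ (Fin n)))).restrict_preimage hK
  have hpre : (Neg.neg : EuclideanSpace ℝ (Fin n) → _) ⁻¹' K = K := hsymm.symm
  rw [hpre] at h
  exact h.smul_measure _

lemma memLp_jointUnif_of_continuous [IsProbabilityMeasure (unifMeasure n K)] (hK : IsCompact K)
    {N : ℕ} {f : (Fin N → EuclideanSpace ℝ (Fin n)) → ℝ} (hf : Continuous f) (q : ENNReal) :
    MemLp f q (jointUnif n N K) := by
  have : IsProbabilityMeasure (jointUnif n N K) := by unfold jointUnif; infer_instance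
  obtain ⟨C, hC⟩ := (isCompact_univ_pi fun _ : Fin N => hK).exists_bound_of_continuousOn
    hf.continuousOn
  refine MemLp.of_bound hf.aestronglyMeasurable C ?_
  have hmem : ∀ᵐ y ∂unifMeasure n K, y ∈ K :=
    Measure.ae_smul_measure (ae_restrict_mem hK.measurableSet) _
  have hall : ∀ᵐ x ∂jointUnif n N K, ∀ i, x i ∈ K :=
    ae_all_iff.2 fun i => (Measure.quasiMeasurePreserving_eval _ i).ae hmem
  filter_upwards [hall] with x hx
  exact hC x fun i _ => hx i

lemma integral_abs_rpow_eq_eLpNorm {α : Type*} [MeasurableSpace α] {μ : Measure α} {p : ℝ}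
    (hp : 1 ≤ p) {g : α → ℝ} (hg : MemLp g (ENNReal.ofReal p) μ) {k : ℝ} (hk : 0 ≤ k) :
    (∫ x, |k * (|g x|)| ^ p ∂μ) ^ (1 / p) = k * (eLpNorm g (ENNReal.ofReal p) μ).toReal := by
  have hp0 : 0 < p := by linarith
  have h1 := (hg.const_smul k).eLpNorm_eq_integral_rpow_norm (by simpa using hp0) (by simp)
  rw [eLpNorm_const_smul, ENNReal.toReal_ofReal hp0.le] at h1
  have h2 := congrArg ENNReal.toReal h1
  rw [ENNReal.toReal_mul, ENNReal.toReal_ofReal (by positivity)] at h2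
  simp only [Pi.smul_apply, smul_eq_mul, Real.norm_eq_abs, toReal_enorm, abs_of_nonneg hk] at h2
  simp only [h2, one_div, abs_mul, abs_abs]

/-- Forgetting one of `N + 1` independent uniform points leaves `N` independent uniform points. -/
lemma measurePreserving_comp_succAbove [IsProbabilityMeasure (unifMeasure n K)] {N : ℕ}
    (i : Fin (N + 1)) :
    MeasurePreserving (fun (x : Fin (N + 1) → EuclideanSpace ℝ (Fin n)) k => x (i.succAbove k))
      (jointUnif n (N + 1) K) (jointUnif n N K) :=
  measurePreserving_snd.comp
    (measurePreserving_piFinSuccAbove (fun _ : Fin (N + 1) => unifMeasure n K) i)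

lemma measurePreserving_reflect [IsProbabilityMeasure (unifMeasure n K)]
    (hK : MeasurableSet K) (hsymm : K = -K) {N : ℕ} :
    MeasurePreserving
      (fun x : Fin (N + 1) → EuclideanSpace ℝ (Fin n) => Function.update x 0 (-x 0))
      (jointUnif n (N + 1) K) (jointUnif n (N + 1) K) := by
  have h := measurePreserving_pi (fun _ : Fin (N + 1) => unifMeasure n K)
    (fun _ => unifMeasure n K) (f := fun i => if i = 0 then Neg.neg else id) (by
      intro i
      by_cases hi : i = 0
      · simpa [hi] using measurePreserving_neg_unifMeasure hK hsymm
      · simpa [hi] using MeasurePreserving.id (unifMeasure n K))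
  change MeasurePreserving _ (Measure.pi _) (Measure.pi _)
  convert h using 1
  ext1 x
  ext1 i
  by_cases hi : i = 0
  · subst hi; simp
  · simp [hi]

lemma eLpNorm_det_augMatrix_le [IsProbabilityMeasure (unifMeasure n K)] {q : ENNReal}
    (hq : 1 ≤ q) :
    eLpNorm (fun x => (augMatrix x).det) q (jointUnif n (n + 1) K) ≤
      (n + 1) * eLpNorm rowDet q (jointUnif n n K) := by
  have hcont : ∀ i : Fin (n + 1), Continuous
      fun x : Fin (n + 1) → EuclideanSpace ℝ (Fin n) => rowDet fun k => x (i.succAbove k) :=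
    fun i => continuous_rowDet.comp (by fun_prop)
  have hsum : (fun x => (augMatrix x).det) = ∑ i : Fin (n + 1), ((-1 : ℝ) ^ (i : ℕ)) •
      fun x : Fin (n + 1) → EuclideanSpace ℝ (Fin n) => rowDet fun k => x (i.succAbove k) := by
    ext x
    simp [det_augMatrix]
  rw [hsum]
  refine (eLpNorm_sum_le (fun i _ =>
    ((hcont i).const_smul _).aestronglyMeasurable) hq).trans_eq ?_
  have hterm : ∀ i : Fin (n + 1), eLpNorm (((-1 : ℝ) ^ (i : ℕ)) •
      fun x : Fin (n + 1) → EuclideanSpace ℝ (Fin n) => rowDet fun k => x (i.succAbove k)) q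
      (jointUnif n (n + 1) K) = eLpNorm rowDet q (jointUnif n n K) := by
    intro i
    rw [eLpNorm_const_smul, ← eLpNorm_comp_measurePreserving
      continuous_rowDet.aestronglyMeasurable (measurePreserving_comp_succAbove i)]
    simp [Function.comp_def, enorm_pow]
  simp [hterm]

lemma eLpNorm_rowDet_le [IsProbabilityMeasure (unifMeasure n K)] (hK : MeasurableSet K)
    (hsymm : K = -K) {q : ENNReal} (hq : 1 ≤ q) :
    eLpNorm rowDet q (jointUnif n n K) ≤
      eLpNorm (fun x => (augMatrix x).det) q (jointUnif n (n + 1) K) := by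
  set μ := jointUnif n (n + 1) K
  set F : (Fin (n + 1) → EuclideanSpace ℝ (Fin n)) → ℝ := fun x => (augMatrix x).det with hF
  set σ : (Fin (n + 1) → EuclideanSpace ℝ (Fin n)) → Fin (n + 1) → EuclideanSpace ℝ (Fin n) :=
    fun x => Function.update x 0 (-x 0) with hσ
  have hFc : Continuous F := continuous_det_augMatrix
  have hσc : Continuous σ := by fun_prop
  have hFm : AEStronglyMeasurable F μ := hFc.aestronglyMeasurable
  have hrefl : eLpNorm (F ∘ σ) q μ = eLpNorm F q μ :=
    eLpNorm_comp_measurePreserving hFm (measurePreserving_reflect hK hsymm)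
  have hD : eLpNorm rowDet q (jointUnif n n K) =
      eLpNorm ((2⁻¹ : ℝ) • (F + F ∘ σ)) q μ := by
    rw [← eLpNorm_comp_measurePreserving
      continuous_rowDet.aestronglyMeasurable (measurePreserving_comp_succAbove 0)]
    congr 1
    ext x
    simp [hF, hσ, det_augMatrix_add_reflect]
  have hhalf : ‖(2⁻¹ : ℝ)‖ₑ = 2⁻¹ := by
    rw [Real.enorm_eq_ofReal (by norm_num), ENNReal.ofReal_inv_of_pos (by norm_num)]
    simp
  calc eLpNorm rowDet q (jointUnif n n K)
      = 2⁻¹ * eLpNorm (F + F ∘ σ) q μ := by rw [hD, eLpNorm_const_smul, hhalf]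
    _ ≤ 2⁻¹ * (eLpNorm F q μ + eLpNorm (F ∘ σ) q μ) := by
        gcongr
        exact eLpNorm_add_le hFm (hFc.comp hσc).aestronglyMeasurable hq
    _ = eLpNorm F q μ := by
        rw [hrefl, ← two_mul, ← mul_assoc, ENNReal.inv_mul_cancel (by simp) (by simp), one_mul]

end Moments

/-- For a symmetric convex body `K ⊆ ℝⁿ` and `1 ≤ p < ∞`,
`‖U_K‖_p ≤ ((n+1)/2ⁿ) ‖V_K‖_p` and `‖V_K‖_p ≤ 2ⁿ ‖U_K‖_p`. -/
theorem lpNorm_randSimplexVol_randCrossVol_comparison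
    (n : ℕ) (hn : 0 < n)
    (K : Set (EuclideanSpace ℝ (Fin n)))
    (hK_conv : Convex ℝ K) (hK_comp : IsCompact K)
    (hK_int : (interior K).Nonempty) (hK_symm : K = -K)
    (p : ℝ) (hp : 1 ≤ p) :
    lpNormU n K p ≤ ((n + 1 : ℝ) / 2 ^ n) * lpNormV n K p ∧
      lpNormV n K p ≤ 2 ^ n * lpNormU n K p := by
  have h0 : volume K ≠ 0 := (Measure.measure_pos_of_nonempty_interior volume hK_int).ne'
  have htop : volume K ≠ ⊤ := hK_comp.measure_lt_top.ne
  have := isProbabilityMeasure_unifMeasure h0 htop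
  have hq : 1 ≤ ENNReal.ofReal p := by simpa using hp
  have hFmem := memLp_jointUnif_of_continuous hK_comp continuous_det_augMatrix (ENNReal.ofReal p)
  have hDmem := memLp_jointUnif_of_continuous hK_comp (continuous_rowDet (n := n))
    (ENNReal.ofReal p)
  set c : ℝ := (volume (cornerSimplex n)).toReal / (volume K).toReal with hc
  have hc0 : 0 ≤ c := by positivity
  have hU : lpNormU n K p =
      c * (eLpNorm (fun x => (augMatrix x).det) (ENNReal.ofReal p)
        (jointUnif n (n + 1) K)).toReal := by
    rw [← integral_abs_rpow_eq_eLpNorm hp hFmem hc0, lpNormU]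
    simp only [randSimplexVol, volume_convexHull_range, ENNReal.toReal_mul,
      ENNReal.toReal_ofReal (abs_nonneg _), hc, mul_div_assoc, mul_comm]
  have hV : lpNormV n K p =
      2 ^ n * c * (eLpNorm rowDet (ENNReal.ofReal p) (jointUnif n n K)).toReal := by
    rw [← integral_abs_rpow_eq_eLpNorm hp hDmem (by positivity), lpNormV]
    have hrand : ∀ x, randCrossVol n K x = 2 ^ n * c * |rowDet x| := by
      intro x
      rw [randCrossVol, volume_convexHull_range_union_neg hn, ENNReal.toReal_mul,
        ENNReal.toReal_mul, ENNReal.toReal_ofReal (abs_nonneg _), hc]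
      simp only [ENNReal.toReal_pow, ENNReal.toReal_ofNat]
      ring
    simp only [hrand]
  have h1 := ENNReal.toReal_mono (ENNReal.mul_ne_top (by finiteness) hDmem.eLpNorm_ne_top)
    (eLpNorm_det_augMatrix_le (K := K) hq)
  have h2 := ENNReal.toReal_mono hFmem.eLpNorm_ne_top
    (eLpNorm_rowDet_le hK_comp.measurableSet hK_symm hq)
  have hcast : ((n : ENNReal) + 1).toReal = (n : ℝ) + 1 := by
    exact_mod_cast ENNReal.toReal_natCast (n + 1)
  rw [ENNReal.toReal_mul, hcast] at h1
  rw [hU, hV]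
  constructor
  · refine (mul_le_mul_of_nonneg_left h1 hc0).trans_eq ?_
    field_simp
  · rw [mul_assoc]
    gcongr
end
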